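/- arXiv:2603.27489 — 3 statements merged into one kernel-verified Lean document; each statement's English description precedes it below -/
import Mathlib

section
/- Let G be a connected finite simple graph with at least one pendant vertex, consisting of n ≥ 4 edges. Then λ_{1,2}(G) ≥ λ_{1,2}(T_{n,3}), and equality holds if and only if G is isomorphic to the tadpole graph T_{n,3}. -/
attribute [local instance] Classical.propDecidable

open Finset

/-- The degree of a vertex `x` in a finite simple graph `G`. -/
noncomputable def deg {V : Type*} [Fintype V] (G : SimpleGraph V) (x : V) : ℕ :=
  (Finset.univ.filter (fun y => G.Adj x y)).card

/-- The `p`-energy `‖df‖_{p,G}^p = Σ_{{x,y} ∈ E(G)} |f x - f y|^p`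
(each unordered edge counted once, i.e. half the double sum). -/
noncomputable def energy {V : Type*} [Fintype V] (G : SimpleGraph V) (p : ℝ) (f : V → ℝ) : ℝ :=
  (∑ x : V, ∑ y : V, if G.Adj x y then |f x - f y| ^ p else 0) / 2

/-- The weighted `p`-norm `‖f‖_{p,G}^p = Σ_x |f x|^p · deg x`. -/
noncomputable def pnorm {V : Type*} [Fintype V] (G : SimpleGraph V) (p : ℝ) (f : V → ℝ) : ℝ :=
  ∑ x : V, |f x| ^ p * (deg G x : ℝ)

/-- The `p`-Rayleigh quotient `R_{p,G}[f]`. -/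
noncomputable def rayleigh {V : Type*} [Fintype V] (G : SimpleGraph V) (p : ℝ) (f : V → ℝ) : ℝ :=
  energy G p f / pnorm G p f

/-- The first `p`-Dirichlet eigenvalue `λ_{1,p}(G)`: the infimum of Rayleigh quotients of
nonzero functions vanishing on the boundary `B(G)` (the set of pendant vertices). -/
noncomputable def lambda1 {V : Type*} [Fintype V] (G : SimpleGraph V) (p : ℝ) : ℝ :=
  sInf { r : ℝ | ∃ f : V → ℝ, (∀ x : V, deg G x = 1 → f x = 0) ∧ f ≠ 0 ∧ r = rayleigh G p f }

/-- The number of edges with exactly one endpoint in `U`. -/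
noncomputable def cutCard {V : Type*} [Fintype V] (G : SimpleGraph V) (U : Finset V) : ℕ :=
  ∑ x ∈ U, (Finset.univ.filter (fun y => G.Adj x y ∧ y ∉ U)).card

/-- The Dirichlet Cheeger constant `h_D(G)`. -/
noncomputable def cheeger {V : Type*} [Fintype V] (G : SimpleGraph V) : ℝ :=
  sInf { r : ℝ | ∃ U : Finset V, U.Nonempty ∧ (∀ x ∈ U, deg G x ≠ 1) ∧
    r = (cutCard G U : ℝ) / ∑ x ∈ U, (deg G x : ℝ) }

/-- The tadpole graph `T_{n,i}` on vertices `0, …, n-1` (vertex `k-1` representing `t_k`):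
edges between consecutive vertices together with the edge `t_1 ∼ t_i`. -/
def tadpole (n i : ℕ) : SimpleGraph (Fin n) :=
  SimpleGraph.fromRel (fun a b => b.val = a.val + 1 ∨ (a.val = 0 ∧ b.val = i - 1))

/-- The path graph on `n` vertices. -/
def pathG (n : ℕ) : SimpleGraph (Fin n) :=
  SimpleGraph.fromRel (fun a b => b.val = a.val + 1)


namespace FK

/-- edge form -/
def eform (c : ℝ) (a b : ℝ) : ℝ := c * a ^ 2 + c * b ^ 2 - 2 * a * b

lemma eform_comm (c a b : ℝ) : eform c a b = eform c b a := by unfold eform; ring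

/-- edge form on unordered pairs -/
noncomputable def eS {V : Type*} (c : ℝ) (f : V → ℝ) : Sym2 V → ℝ :=
  Sym2.lift ⟨fun x y => eform c (f x) (f y), fun x y => eform_comm c (f x) (f y)⟩

lemma eS_mk {V : Type*} (c : ℝ) (f : V → ℝ) (x y : V) :
    eS c f s(x, y) = eform c (f x) (f y) := rfl

/-- total along a walk -/
noncomputable def wsum {V : Type*} {G : SimpleGraph V} (c : ℝ) (f : V → ℝ) {x y : V}
    (w : G.Walk x y) : ℝ := (w.edges.map (eS c f)).sum

lemma energy_two {V : Type*} [Fintype V] (G : SimpleGraph V) (f : V → ℝ) :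
    energy G 2 f = (∑ x : V, ∑ y : V, if G.Adj x y then (f x - f y) ^ 2 else 0) / 2 := by
  unfold energy
  simp only [Real.rpow_two, sq_abs]

lemma pnorm_two {V : Type*} [Fintype V] (G : SimpleGraph V) (f : V → ℝ) :
    pnorm G 2 f = ∑ x : V, ∑ y : V, if G.Adj x y then f x ^ 2 else 0 := by
  unfold pnorm deg
  simp only [Real.rpow_two, sq_abs]
  refine Finset.sum_congr rfl fun x _ => ?_
  rw [← Finset.sum_filter, Finset.sum_const, nsmul_eq_mul, mul_comm]

lemma pnorm_two' {V : Type*} [Fintype V] (G : SimpleGraph V) (f : V → ℝ) :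
    pnorm G 2 f = ∑ x : V, ∑ y : V, if G.Adj x y then f y ^ 2 else 0 := by
  rw [pnorm_two, Finset.sum_comm]
  simp only [G.adj_comm]

lemma form_eq {V : Type*} [Fintype V] (G : SimpleGraph V) (c : ℝ) (f : V → ℝ) :
    2 * (energy G 2 f - (1 - c) * pnorm G 2 f) =
      ∑ x : V, ∑ y : V, if G.Adj x y then eform c (f x) (f y) else 0 := by
  have h1 := pnorm_two G f
  have h2 := pnorm_two' G f
  have : 2 * (energy G 2 f - (1 - c) * pnorm G 2 f) =
    2 * energy G 2 f - (1 - c) * pnorm G 2 f - (1 - c) * pnorm G 2 f := by ring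
  rw [this]
  nth_rewrite 1 [h1]
  rw [h2, energy_two, mul_div_cancel₀ _ (two_ne_zero)]
  simp only [Finset.mul_sum, ← Finset.sum_sub_distrib]
  refine Finset.sum_congr rfl fun x _ => Finset.sum_congr rfl fun y _ => ?_
  split_ifs
  · unfold eform; ring
  · ring

lemma sum_adj_eq {V : Type*} [Fintype V] (G : SimpleGraph V) (F : Sym2 V → ℝ) :
    (∑ x : V, ∑ y : V, if G.Adj x y then F s(x, y) else 0) = 2 * ∑ e ∈ G.edgeFinset, F e := by
  have h1 : (∑ d : G.Dart, F d.edge) = 2 * ∑ e ∈ G.edgeFinset, F e := by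
    rw [← Finset.sum_fiberwise_of_maps_to (s := Finset.univ) (t := G.edgeFinset)
      (g := fun d : G.Dart => d.edge) (fun d _ => by simp [d.edge_mem]), Finset.mul_sum]
    refine Finset.sum_congr rfl fun e he => ?_
    rw [Finset.sum_congr rfl (g := fun _ => F e) (fun d hd => by
      rw [(Finset.mem_filter.1 hd).2]), Finset.sum_const]
    have := G.dart_edge_fiber_card e (by simpa using he)
    rw [nsmul_eq_mul]
    congr 1
    exact_mod_cast this
  rw [← h1, ← Finset.sum_product', Finset.univ_product_univ, ← Finset.sum_filter]
  symm
  refine Finset.sum_bij (fun d _ => d.toProd) ?_ ?_ ?_ ?_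
  · intro d _; simp
  · intro d _ d' _ h; exact SimpleGraph.Dart.ext _ _ h
  · intro b hb
    exact ⟨⟨b, by simpa using hb⟩, Finset.mem_univ _, rfl⟩
  · intro d _; rfl

lemma form_eq_edges {V : Type*} [Fintype V] (G : SimpleGraph V) (c : ℝ) (f : V → ℝ) :
    energy G 2 f - (1 - c) * pnorm G 2 f = ∑ e ∈ G.edgeFinset, eS c f e := by
  have h := form_eq G c f
  have h2 := sum_adj_eq G (eS c f)
  simp only [eS_mk] at h2
  linarith

/-- one Riccati step -/
lemma step {θ φ a b : ℝ} (h1 : 0 < Real.sin φ) (h2 : 0 < Real.sin (φ + θ)) :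
    Real.sin θ * (Real.cos (φ + θ) / Real.sin (φ + θ)) * b ^ 2
      - Real.sin θ * (Real.cos φ / Real.sin φ) * a ^ 2 ≤ eform (Real.cos θ) a b := by
  have e1 : Real.sin θ = Real.sin (φ + θ) * Real.cos φ - Real.cos (φ + θ) * Real.sin φ := by
    rw [← Real.sin_sub]; congr 1; ring
  have e2 : Real.cos θ = Real.cos (φ + θ) * Real.cos φ + Real.sin (φ + θ) * Real.sin φ := by
    rw [← Real.cos_sub]; congr 1; ring
  have p1 := Real.sin_sq_add_cos_sq φ
  have p2 := Real.sin_sq_add_cos_sq (φ + θ)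
  set S := Real.sin (φ + θ)
  set C := Real.cos (φ + θ)
  set S' := Real.sin φ
  set C' := Real.cos φ
  have : eform (Real.cos θ) a b - (Real.sin θ * (C / S) * b ^ 2
      - Real.sin θ * (C' / S') * a ^ 2) = (S * a - S' * b) ^ 2 / (S * S') := by
    rw [e1, e2]; unfold eform
    have : S ≠ 0 := h2.ne'
    have : S' ≠ 0 := h1.ne'
    field_simp
    have p3 : C' ^ 2 = 1 - S' ^ 2 := by linarith
    have p4 : C ^ 2 = 1 - S ^ 2 := by linarith
    ring_nf
    rw [p3, p4]
    ring
  have h3 : 0 ≤ (S * a - S' * b) ^ 2 / (S * S') := by positivity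
  linarith

lemma wsum_ge {V : Type*} {G : SimpleGraph V} (f : V → ℝ) {θ : ℝ} (hθ : 0 < θ) {x y : V}
    (w : G.Walk x y) : ∀ φ : ℝ, 0 < φ → φ + w.length * θ < Real.pi →
    Real.sin θ * (Real.cos (φ + w.length * θ) / Real.sin (φ + w.length * θ)) * f y ^ 2
      - Real.sin θ * (Real.cos φ / Real.sin φ) * f x ^ 2 ≤ wsum (Real.cos θ) f w := by
  induction w with
  | nil => intro φ _ _; simp [wsum]
  | @cons u v z h p ih =>
    intro φ h0 h1
    have hl : ((SimpleGraph.Walk.cons h p).length : ℝ) = p.length + 1 := by simp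
    rw [hl] at h1 ⊢
    have hp : (0 : ℝ) ≤ p.length * θ := by positivity
    have e : φ + (p.length + 1 : ℝ) * θ = φ + θ + p.length * θ := by ring
    rw [e] at h1 ⊢
    have := ih (φ + θ) (by linarith) h1
    have s := step (θ := θ) (φ := φ) (a := f u) (b := f v)
      (Real.sin_pos_of_pos_of_lt_pi h0 (by linarith))
      (Real.sin_pos_of_pos_of_lt_pi (by linarith) (by linarith))
    have hw : wsum (Real.cos θ) f (SimpleGraph.Walk.cons h p)
      = eform (Real.cos θ) (f u) (f v) + wsum (Real.cos θ) f p := by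
      simp [wsum, eS_mk]
    rw [hw]; linarith

lemma wsum_closed {V : Type*} {G : SimpleGraph V} (f : V → ℝ) {θ : ℝ} (hθ : 0 < θ) {x : V}
    (w : G.Walk x x) (h : w.length * θ < Real.pi) :
    - (2 * Real.sin θ * (Real.sin (w.length * θ / 2) / Real.cos (w.length * θ / 2)) * f x ^ 2)
      ≤ wsum (Real.cos θ) f w := by
  have := wsum_ge f hθ w (Real.pi / 2 - w.length * θ / 2) (by linarith)
    (by linarith)
  have e : Real.pi / 2 - w.length * θ / 2 + w.length * θ = Real.pi / 2 + w.length * θ / 2 := by ring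
  rw [e, Real.cos_pi_div_two_sub, Real.sin_pi_div_two_sub, add_comm (Real.pi / 2),
    Real.cos_add_pi_div_two, Real.sin_add_pi_div_two] at this
  refine le_trans (le_of_eq ?_) this
  ring

lemma wsum_dir {V : Type*} {G : SimpleGraph V} (f : V → ℝ) {θ : ℝ} (hθ : 0 < θ) {x y : V}
    (w : G.Walk x y) (hx : f x = 0) (hl : 1 ≤ w.length) (h : w.length * θ < Real.pi) :
    Real.sin θ * (Real.cos (w.length * θ) / Real.sin (w.length * θ)) * f y ^ 2
      ≤ wsum (Real.cos θ) f w := by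
  cases w with
  | nil => simp at hl
  | @cons u v z h' p =>
    have hl : ((SimpleGraph.Walk.cons h' p).length : ℝ) = p.length + 1 := by simp
    rw [hl] at h ⊢
    have hp : (0 : ℝ) ≤ p.length * θ := by positivity
    have := wsum_ge f hθ p θ hθ (by linarith)
    have hw : wsum (Real.cos θ) f (SimpleGraph.Walk.cons h' p)
      = eform (Real.cos θ) (f x) (f v) + wsum (Real.cos θ) f p := by
      simp [wsum, eS_mk]
    have e : (p.length + 1 : ℝ) * θ = θ + p.length * θ := by ring
    rw [hw, e, hx]
    have hs : Real.sin θ ≠ 0 := (Real.sin_pos_of_pos_of_lt_pi hθ (by linarith)).ne'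
    have : Real.sin θ * (Real.cos θ / Real.sin θ) * f v ^ 2 = Real.cos θ * f v ^ 2 := by
      field_simp
    unfold eform
    simp only [ne_eq, OfNat.ofNat_ne_zero, not_false_eq_true, zero_pow, mul_zero, zero_mul]
    linarith

/-- insert a back-and-forth -/
lemma insert_edge {V : Type*} {G : SimpleGraph V} {a b x y : V} (P : G.Walk a b)
    (hx : x ∈ P.support) (h : G.Adj x y) :
    ∃ P' : G.Walk a b, P'.length = P.length + 2 ∧
      ∀ e, P'.edges.count e = P.edges.count e + if e = s(x, y) then 2 else 0 := by
  refine ⟨(P.takeUntil x hx).append (.cons h (.cons h.symm (P.dropUntil x hx))), ?_, ?_⟩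
  · have := congrArg SimpleGraph.Walk.length (P.take_spec hx)
    rw [SimpleGraph.Walk.length_append] at this
    simp only [SimpleGraph.Walk.length_append, SimpleGraph.Walk.length_cons]
    omega
  · intro e
    have := congrArg (fun w => w.edges.count e) (P.take_spec hx)
    simp only [SimpleGraph.Walk.edges_append, List.count_append] at this
    rw [← this]
    simp only [SimpleGraph.Walk.edges_append, List.count_append, SimpleGraph.Walk.edges_cons,
      List.count_cons, Sym2.eq_swap (a := y) (b := x)]
    by_cases he : e = s(x, y)
    · simp [he]; omega
    · simp [he, Ne.symm he]

lemma fill {V : Type*} [Fintype V] {G : SimpleGraph V} (hG : G.Connected) (k : ℕ) :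
    ∀ {a b c : V} (P : G.Walk a b) (C : G.Walk b c),
    (G.edgeFinset.filter (fun e => e ∉ P.edges ++ C.edges)).card = k →
    ∃ (P' : G.Walk a b) (C' : G.Walk b c), P.length ≤ P'.length ∧ C.length ≤ C'.length ∧
      ∀ e ∈ G.edgeSet, (P'.edges ++ C'.edges).count e =
        if e ∈ P.edges ++ C.edges then (P.edges ++ C.edges).count e else 2 := by
  induction k with
  | zero =>
    intro a b c P C h
    refine ⟨P, C, le_rfl, le_rfl, fun e he => ?_⟩
    rw [Finset.card_eq_zero, Finset.filter_eq_empty_iff] at h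
    have := h (x := e) (by simpa using he)
    rw [not_not] at this
    rw [if_pos this]
  | succ k ih =>
    intro a b c P C h
    obtain ⟨x, y, hx, hxy, hn⟩ : ∃ x y, (x ∈ P.support ∨ x ∈ C.support) ∧ ∃ h : G.Adj x y,
        s(x, y) ∉ P.edges ++ C.edges := by
      by_contra hcon
      push Not at hcon
      have hclosed : ∀ {u v : V} (w : G.Walk u v), (u ∈ P.support ∨ u ∈ C.support) →
          (v ∈ P.support ∨ v ∈ C.support) := by
        intro u v w
        induction w with
        | nil => exact id
        | @cons u v z h p ih =>
          intro hu
          apply ih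
          have := hcon u v hu h
          rw [List.mem_append] at this
          rcases this with h | h
          · exact Or.inl (P.snd_mem_support_of_mem_edges h)
          · exact Or.inr (C.snd_mem_support_of_mem_edges h)
      have hpos : 0 < (G.edgeFinset.filter (fun e => e ∉ P.edges ++ C.edges)).card := by omega
      obtain ⟨e, he⟩ := Finset.card_pos.1 hpos
      rw [Finset.mem_filter, SimpleGraph.mem_edgeFinset] at he
      obtain ⟨he, hne⟩ := he
      induction e with
      | _ u v =>
        obtain ⟨w⟩ := hG.preconnected a u
        exact hne (hcon u v (hclosed w (Or.inl P.start_mem_support)) he)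
    obtain ⟨P1, C1, l1, l2, hc⟩ : ∃ (P1 : G.Walk a b) (C1 : G.Walk b c),
        P.length ≤ P1.length ∧ C.length ≤ C1.length ∧
        ∀ e, (P1.edges ++ C1.edges).count e =
          (P.edges ++ C.edges).count e + if e = s(x, y) then 2 else 0 := by
      rcases hx with hx | hx
      · obtain ⟨P1, h1, h2⟩ := insert_edge P hx hxy
        refine ⟨P1, C, by omega, le_rfl, fun e => ?_⟩
        rw [List.count_append, List.count_append, h2]; omega
      · obtain ⟨P1, h1, h2⟩ := insert_edge C hx hxy
        refine ⟨P, P1, le_rfl, by omega, fun e => ?_⟩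
        rw [List.count_append, List.count_append, h2]; omega
    have hmem : ∀ e, e ∈ P1.edges ++ C1.edges ↔ (e ∈ P.edges ++ C.edges ∨ e = s(x, y)) := by
      intro e
      rw [← List.count_pos_iff, hc e, ← List.count_pos_iff (l := P.edges ++ C.edges)]
      split_ifs with h <;> simp [h]
    obtain ⟨P2, C2, m1, m2, hc2⟩ := ih P1 C1 (by
      have : (G.edgeFinset.filter (fun e => e ∉ P1.edges ++ C1.edges)) =
          (G.edgeFinset.filter (fun e => e ∉ P.edges ++ C.edges)).erase s(x, y) := by
        ext e
        simp only [Finset.mem_filter, Finset.mem_erase, hmem]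
        tauto
      rw [this, Finset.card_erase_of_mem, h]
      · rfl
      · simp only [Finset.mem_filter, SimpleGraph.mem_edgeFinset]
        exact ⟨hxy, hn⟩)
    refine ⟨P2, C2, l1.trans m1, l2.trans m2, fun e he => ?_⟩
    rw [hc2 e he]
    by_cases h1 : e = s(x, y)
    · rw [if_pos ((hmem e).2 (Or.inr h1)), hc, if_pos h1, h1, if_neg hn,
        List.count_eq_zero_of_not_mem hn]
    · by_cases h2 : e ∈ P.edges ++ C.edges
      · rw [if_pos ((hmem e).2 (Or.inl h2)), if_pos h2, hc, if_neg h1]; rfl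
      · rw [if_neg (fun h => ((hmem e).1 h).elim h2 h1), if_neg h2]

/-- Given an edge-simple pair of walks, a double cover. -/
lemma cover {V : Type*} [Fintype V] {G : SimpleGraph V} (hG : G.Connected)
    {a b c : V} (P : G.Walk a b) (C : G.Walk b c) (hnd : (P.edges ++ C.edges).Nodup) :
    ∃ (P' : G.Walk a b) (C' : G.Walk b c), P.length ≤ P'.length ∧ C.length ≤ C'.length ∧
      P'.length + C'.length + P.length + C.length = 2 * G.edgeFinset.card ∧
      ∀ (κ : ℝ) (f : V → ℝ), wsum κ f P' + wsum κ f C' + wsum κ f P + wsum κ f C =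
        2 * (energy G 2 f - (1 - κ) * pnorm G 2 f) := by
  obtain ⟨P', C', h1, h2, h3⟩ := fill hG _ P C rfl
  have key : ((P'.edges ++ C'.edges ++ (P.edges ++ C.edges) : List (Sym2 V)) : Multiset (Sym2 V))
      = 2 • G.edgeFinset.val := by
    ext e
    rw [Multiset.coe_count, List.count_append, Multiset.count_nsmul]
    by_cases he : e ∈ G.edgeSet
    · rw [h3 e he, Multiset.count_eq_one_of_mem G.edgeFinset.nodup (by simpa using he)]
      by_cases hm : e ∈ P.edges ++ C.edges
      · rw [if_pos hm, List.count_eq_one_of_mem hnd hm]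
      · rw [if_neg hm, List.count_eq_zero_of_not_mem hm]
    · have hW : ∀ {u v : V} (w : G.Walk u v), w.edges.count e = 0 := fun w =>
        List.count_eq_zero_of_not_mem fun h => he (w.edges_subset_edgeSet h)
      rw [Multiset.count_eq_zero_of_notMem (by simpa using he)]
      simp [List.count_append, hW]
  refine ⟨P', C', h1, h2, ?_, fun κ f => ?_⟩
  · have := congrArg Multiset.card key
    simp at this
    rw [← this]; omega
  · have := congrArg (fun m => (Multiset.map (eS κ f) m).sum) key
    rw [form_eq_edges]
    simp only [Multiset.map_coe, Multiset.sum_coe, List.map_append, List.sum_append,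
      Multiset.map_nsmul, Multiset.sum_nsmul] at this
    unfold wsum
    rw [nsmul_eq_mul] at this
    simp only [Finset.sum]
    push_cast at this
    linarith


lemma cot_add_le {A B : ℝ} (hA : 0 < A) (hB : 0 < B) (hAB : A + B < Real.pi) :
    2 * (Real.cos ((A + B) / 2) / Real.sin ((A + B) / 2)) ≤
      Real.cos A / Real.sin A + Real.cos B / Real.sin B ∧
    (A ≠ B → 2 * (Real.cos ((A + B) / 2) / Real.sin ((A + B) / 2)) <
      Real.cos A / Real.sin A + Real.cos B / Real.sin B) := by
  have sA := Real.sin_pos_of_pos_of_lt_pi hA (by linarith)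
  have sB := Real.sin_pos_of_pos_of_lt_pi hB (by linarith)
  have sS := Real.sin_pos_of_pos_of_lt_pi (x := (A + B) / 2) (by linarith) (by linarith)
  have cS := Real.cos_pos_of_mem_Ioo (x := (A + B) / 2) ⟨by linarith, by linarith⟩
  have e1 : Real.cos A / Real.sin A + Real.cos B / Real.sin B
      = 2 * Real.sin ((A + B) / 2) * Real.cos ((A + B) / 2) / (Real.sin A * Real.sin B) := by
    have : 2 * Real.sin ((A + B) / 2) * Real.cos ((A + B) / 2) = Real.sin (A + B) := by
      rw [← Real.sin_two_mul]; congr 1; ring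
    rw [this, Real.sin_add]; field_simp; ring
  have e2 : Real.sin A * Real.sin B = Real.sin ((A + B) / 2) ^ 2 - Real.sin ((A - B) / 2) ^ 2 := by
    have h1 : A = (A + B) / 2 + (A - B) / 2 := by ring
    have h2 : B = (A + B) / 2 - (A - B) / 2 := by ring
    have : Real.sin A * Real.sin B = Real.sin ((A + B) / 2 + (A - B) / 2) *
      Real.sin ((A + B) / 2 - (A - B) / 2) := by rw [← h1, ← h2]
    rw [this, Real.sin_add, Real.sin_sub]
    have p1 := Real.sin_sq_add_cos_sq ((A + B) / 2)
    have p2 := Real.sin_sq_add_cos_sq ((A - B) / 2)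
    have p3 : Real.cos ((A + B) / 2) ^ 2 = 1 - Real.sin ((A + B) / 2) ^ 2 := by linarith
    have p4 : Real.cos ((A - B) / 2) ^ 2 = 1 - Real.sin ((A - B) / 2) ^ 2 := by linarith
    ring_nf at p3 p4 ⊢
    rw [p3, p4]; ring
  have e3 : 2 * (Real.cos ((A + B) / 2) / Real.sin ((A + B) / 2)) =
      2 * Real.sin ((A + B) / 2) * Real.cos ((A + B) / 2) / Real.sin ((A + B) / 2) ^ 2 := by
    field_simp
  rw [e1, e3]
  have hp : 0 < Real.sin A * Real.sin B := mul_pos sA sB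
  constructor
  · apply div_le_div_of_nonneg_left (by positivity) hp
    rw [e2]; linarith [sq_nonneg (Real.sin ((A - B) / 2))]
  · intro hne
    apply div_lt_div_of_pos_left (by positivity) hp
    rw [e2]
    have : Real.sin ((A - B) / 2) ≠ 0 := by
      rw [Ne, Real.sin_eq_zero_iff_of_lt_of_lt (by linarith) (by linarith)]
      intro h; apply hne; linarith
    linarith [sq_pos_of_ne_zero this]

lemma tan_add_le {h L1 L2 : ℝ} (h0 : 0 < h) (h1 : h ≤ L1) (h2 : h ≤ L2)
    (hM : L1 + L2 < Real.pi / 2) :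
    Real.sin L1 / Real.cos L1 + Real.sin L2 / Real.cos L2 ≤
      Real.sin h / Real.cos h + Real.sin (L1 + L2 - h) / Real.cos (L1 + L2 - h) := by
  have key : ∀ u v : ℝ, 0 < u → 0 < v → u + v < Real.pi / 2 →
      0 < Real.cos u * Real.cos v ∧
      Real.sin u / Real.cos u + Real.sin v / Real.cos v =
        Real.sin (u + v) / (Real.cos u * Real.cos v) ∧
      Real.cos u * Real.cos v = (Real.cos (u + v) + Real.cos |u - v|) / 2 := by
    intro u v hu hv huv
    have c1 := Real.cos_pos_of_mem_Ioo (x := u) ⟨by linarith, by linarith⟩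
    have c2 := Real.cos_pos_of_mem_Ioo (x := v) ⟨by linarith, by linarith⟩
    refine ⟨mul_pos c1 c2, ?_, ?_⟩
    · rw [Real.sin_add]; field_simp
    · rw [Real.cos_abs, Real.cos_add, Real.cos_sub]; ring
  obtain ⟨a1, a2, a3⟩ := key L1 L2 (by linarith) (by linarith) hM
  obtain ⟨b1, b2, b3⟩ := key h (L1 + L2 - h) h0 (by linarith) (by linarith)
  have e : h + (L1 + L2 - h) = L1 + L2 := by ring
  rw [e] at b2 b3
  rw [a2, b2]
  apply div_le_div_of_nonneg_left _ b1
  · rw [a3, b3]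
    have : Real.cos |h - (L1 + L2 - h)| ≤ Real.cos |L1 - L2| := by
      apply Real.cos_le_cos_of_nonneg_of_le_pi (abs_nonneg _)
      · rw [abs_le]; constructor <;> linarith
      · rw [abs_of_nonpos (by linarith : h - (L1 + L2 - h) ≤ 0)]
        apply abs_le.2; constructor <;> linarith
    linarith
  · exact (Real.sin_pos_of_pos_of_lt_pi (by linarith) (by linarith [Real.pi_pos])).le

lemma third {h x Q : ℝ} (h0 : 0 < h) (x0 : 0 ≤ x) (hx : h + x < Real.pi / 2)
    (hQ : x < Q) (hQ2 : Q < Real.pi / 2)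
    (hroot : Real.cos Q * Real.cos h = 2 * Real.sin h * Real.sin Q) :
    Real.sin h / Real.cos h + Real.sin (h + x) / Real.cos (h + x) ≤
      Real.cos (Q - x) / Real.sin (Q - x) ∧
    (0 < x → Real.sin h / Real.cos h + Real.sin (h + x) / Real.cos (h + x) <
      Real.cos (Q - x) / Real.sin (Q - x)) := by
  have ch := Real.cos_pos_of_mem_Ioo (x := h) ⟨by linarith, by linarith⟩
  have cx := Real.cos_pos_of_mem_Ioo (x := x) ⟨by linarith, by linarith⟩
  have chx := Real.cos_pos_of_mem_Ioo (x := h + x) ⟨by linarith, by linarith⟩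
  have sh := Real.sin_pos_of_pos_of_lt_pi (x := h) h0 (by linarith)
  have sx := Real.sin_nonneg_of_nonneg_of_le_pi (x := x) x0 (by linarith)
  have sQ := Real.sin_pos_of_pos_of_lt_pi (x := Q) (by linarith) (by linarith)
  have sQx := Real.sin_pos_of_pos_of_lt_pi (x := Q - x) (by linarith) (by linarith)
  set t := Real.sin h / Real.cos h with ht
  set y := Real.sin x / Real.cos x with hy
  have t0 : 0 < t := div_pos sh ch
  have y0 : 0 ≤ y := div_nonneg sx cx.le
  have esh : Real.sin h = t * Real.cos h := by rw [ht]; field_simp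
  have esx : Real.sin x = y * Real.cos x := by rw [hy]; field_simp
  have ecQ : Real.cos Q = 2 * t * Real.sin Q := by
    rw [ht]; field_simp; linarith
  have d1 : Real.cos (h + x) = (1 - t * y) * (Real.cos h * Real.cos x) := by
    rw [Real.cos_add, esh, esx]; ring
  have n1 : Real.sin (h + x) = (t + y) * (Real.cos h * Real.cos x) := by
    rw [Real.sin_add, esh, esx]; ring
  have d2 : Real.sin (Q - x) = (1 - 2 * t * y) * (Real.sin Q * Real.cos x) := by
    rw [Real.sin_sub, ecQ, esx]; ring
  have n2 : Real.cos (Q - x) = (2 * t + y) * (Real.sin Q * Real.cos x) := by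
    rw [Real.cos_sub, ecQ, esx]; ring
  have k2 : 0 < 1 - 2 * t * y := by
    rw [d2] at sQx
    exact (mul_pos_iff_of_pos_right (mul_pos sQ cx)).1 sQx
  have k1 : 0 < 1 - t * y := by nlinarith
  have e1 : Real.sin (h + x) / Real.cos (h + x) = (t + y) / (1 - t * y) := by
    rw [n1, d1, mul_div_mul_right _ _ (mul_pos ch cx).ne']
  have e2 : Real.cos (Q - x) / Real.sin (Q - x) = (2 * t + y) / (1 - 2 * t * y) := by
    rw [n2, d2, mul_div_mul_right _ _ (mul_pos sQ cx).ne']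
  have e3 : (2 * t + y) / (1 - 2 * t * y) - (t + (t + y) / (1 - t * y)) =
      y * ((1 + 4 * t ^ 2) * (1 - t * y) - (1 + t ^ 2) * (1 - 2 * t * y)) /
        ((1 - t * y) * (1 - 2 * t * y)) := by
    field_simp; ring
  have e4 : 0 < (1 + 4 * t ^ 2) * (1 - t * y) - (1 + t ^ 2) * (1 - 2 * t * y) := by
    have : (1 + 4 * t ^ 2) * (1 - t * y) - (1 + t ^ 2) * (1 - 2 * t * y) =
      t * y * (1 + t ^ 2) + 3 * t ^ 2 * (1 - t * y) := by ring
    rw [this]; positivity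
  rw [e1, e2]
  constructor
  · have : 0 ≤ y * ((1 + 4 * t ^ 2) * (1 - t * y) - (1 + t ^ 2) * (1 - 2 * t * y)) /
        ((1 - t * y) * (1 - 2 * t * y)) := by positivity
    linarith
  · intro hx0
    have : 0 < y := div_pos (Real.sin_pos_of_pos_of_lt_pi (x := x) hx0 (by linarith)) cx
    have : 0 < y * ((1 + 4 * t ^ 2) * (1 - t * y) - (1 + t ^ 2) * (1 - 2 * t * y)) /
        ((1 - t * y) * (1 - 2 * t * y)) := by positivity
    linarith

/-- The characteristic data of the tadpole. -/
def IsRoot (n : ℕ) (θ : ℝ) : Prop :=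
  0 < θ ∧ 2 * ((n : ℝ) - 1) * θ < Real.pi ∧
    Real.cos (((n : ℝ) - 3) * θ) * Real.cos (3 / 2 * θ) =
      2 * Real.sin (3 / 2 * θ) * Real.sin (((n : ℝ) - 3) * θ)

lemma exists_root (n : ℕ) (hn : 4 ≤ n) : ∃ θ, IsRoot n θ := by
  have hn' : (4 : ℝ) ≤ n := by exact_mod_cast hn
  set b : ℝ := Real.pi / (2 * ((n : ℝ) - 1)) with hb
  have hpi := Real.pi_pos
  have hb0 : 0 < b := by apply div_pos hpi; linarith
  have hbn : 2 * ((n : ℝ) - 1) * b = Real.pi := by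
    rw [hb]; field_simp [show (n : ℝ) - 1 ≠ 0 by linarith]
  have hb6 : 6 * b ≤ Real.pi := by nlinarith
  let h : ℝ → ℝ := fun θ => 2 * Real.sin (3 / 2 * θ) * Real.sin (((n : ℝ) - 3) * θ) -
    Real.cos (((n : ℝ) - 3) * θ) * Real.cos (3 / 2 * θ)
  have hc : ContinuousOn h (Set.Icc 0 b) := by
    apply Continuous.continuousOn; fun_prop
  have hend : 0 < h b := by
    have e : ((n : ℝ) - 3) * b = Real.pi / 2 - 2 * b := by linarith
    simp only [h, e, Real.sin_pi_div_two_sub, Real.cos_pi_div_two_sub]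
    have s1 : Real.sin (2 * b) * Real.cos (3 / 2 * b) - Real.cos (2 * b) * Real.sin (3 / 2 * b)
      = Real.sin (b / 2) := by rw [← Real.sin_sub]; congr 1; ring
    have s3 : Real.sin (3 / 2 * b) = 3 * Real.sin (b / 2) - 4 * Real.sin (b / 2) ^ 3 := by
      rw [← Real.sin_three_mul]; congr 1; ring
    have c2 : 1 / 2 ≤ Real.cos (2 * b) := by
      rw [← Real.cos_pi_div_three]
      exact Real.cos_le_cos_of_nonneg_of_le_pi (by linarith) (by linarith) (by linarith)
    have sp : 0 < Real.sin (b / 2) := Real.sin_pos_of_pos_of_lt_pi (by linarith) (by linarith)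
    have sl : Real.sin (b / 2) < 1 / 2 := by
      rw [← Real.sin_pi_div_six]
      exact Real.sin_lt_sin_of_lt_of_le_pi_div_two (by linarith) (by linarith) (by linarith)
    have : 2 * Real.sin (b / 2) < Real.sin (3 / 2 * b) := by rw [s3]; nlinarith [mul_pos sp sp]
    nlinarith
  have hst : h 0 < 0 := by simp [h]
  obtain ⟨θ, hθ, h0⟩ := intermediate_value_Ioo hb0.le hc ⟨hst, hend⟩
  refine ⟨θ, hθ.1, ?_, ?_⟩
  · rw [← hbn]; apply mul_lt_mul_of_pos_left hθ.2; linarith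
  · simp only [h] at h0; linarith

noncomputable def Kf (a b l m : ℕ) (θ : ℝ) : ℝ :=
  Real.cos (a * θ) / Real.sin (a * θ) + Real.cos (b * θ) / Real.sin (b * θ)
   - 2 * (Real.sin (l * θ / 2) / Real.cos (l * θ / 2))
   - 2 * (Real.sin (m * θ / 2) / Real.cos (m * θ / 2))

lemma Kf_pos {n a b l m : ℕ} {θ : ℝ} (hn : 4 ≤ n) (hr : IsRoot n θ) (ha : 1 ≤ a) (hb : 1 ≤ b)
    (hl : 3 ≤ l) (hm : 3 ≤ m) (hsum : a + b + l + m = 2 * n)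
    (hne : ¬ (a = b ∧ l = 3 ∧ m = 3)) : 0 < Kf a b l m θ := by
  obtain ⟨h0, h1, h2⟩ := hr
  have hn' : (4 : ℝ) ≤ n := by exact_mod_cast hn
  have ha' : (1 : ℝ) ≤ a := by exact_mod_cast ha
  have hb' : (1 : ℝ) ≤ b := by exact_mod_cast hb
  have hl' : (3 : ℝ) ≤ l := by exact_mod_cast hl
  have hm' : (3 : ℝ) ≤ m := by exact_mod_cast hm
  have hs' : (a : ℝ) + b + l + m = 2 * n := by exact_mod_cast hsum
  have hsθ : (a : ℝ) * θ + b * θ + l * θ + m * θ = 2 * n * θ := by rw [← hs']; ring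
  have ta : θ ≤ a * θ := by nlinarith
  have tb : θ ≤ b * θ := by nlinarith
  have tl : 3 * θ ≤ l * θ := by nlinarith
  have tm : 3 * θ ≤ m * θ := by nlinarith
  obtain ⟨c1, c2⟩ := cot_add_le (A := a * θ) (B := b * θ) (by linarith) (by linarith) (by linarith)
  have t1 := tan_add_le (h := 3 / 2 * θ) (L1 := l * θ / 2) (L2 := m * θ / 2) (by linarith)
    (by linarith) (by linarith) (by linarith)
  obtain ⟨d1, d2⟩ := third (h := 3 / 2 * θ) (x := l * θ / 2 + m * θ / 2 - 3 * θ)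
    (Q := ((n : ℝ) - 3) * θ) (by linarith) (by linarith) (by linarith) (by linarith) (by linarith) h2
  have e1 : 3 / 2 * θ + (l * θ / 2 + m * θ / 2 - 3 * θ) = l * θ / 2 + m * θ / 2 - 3 / 2 * θ := by
    ring
  have e2 : ((n : ℝ) - 3) * θ - (l * θ / 2 + m * θ / 2 - 3 * θ) = (a * θ + b * θ) / 2 := by
    linarith
  rw [e1, e2] at d1 d2
  unfold Kf
  by_cases hx : 0 < l * θ / 2 + m * θ / 2 - 3 * θ
  · have := d2 hx
    linarith
  · have hab : a * θ ≠ b * θ := by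
      intro h
      have hab : (a : ℝ) = b := mul_right_cancel₀ h0.ne' h
      have : (l : ℝ) + m ≤ 6 := by nlinarith
      have : l + m ≤ 6 := by exact_mod_cast this
      exact hne ⟨by exact_mod_cast hab, by omega, by omega⟩
    have := c2 hab
    linarith

lemma exists_theta {n a b l m : ℕ} {θ : ℝ} (hn : 4 ≤ n) (hr : IsRoot n θ) (ha : 1 ≤ a)
    (hb : 1 ≤ b) (hl : 3 ≤ l) (hm : 3 ≤ m) (hsum : a + b + l + m = 2 * n)
    (hne : ¬ (a = b ∧ l = 3 ∧ m = 3)) :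
    ∃ θ', θ < θ' ∧ 2 * ((n : ℝ) - 1) * θ' < Real.pi ∧ 0 ≤ Kf a b l m θ' := by
  have hK := Kf_pos hn hr ha hb hl hm hsum hne
  obtain ⟨h0, h1, h2⟩ := hr
  have hn' : (4 : ℝ) ≤ n := by exact_mod_cast hn
  have ha' : (1 : ℝ) ≤ a := by exact_mod_cast ha
  have hb' : (1 : ℝ) ≤ b := by exact_mod_cast hb
  have hl' : (3 : ℝ) ≤ l := by exact_mod_cast hl
  have hm' : (3 : ℝ) ≤ m := by exact_mod_cast hm
  have hs' : (a : ℝ) + b + l + m = 2 * n := by exact_mod_cast hsum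
  have hsθ : (a : ℝ) * θ + b * θ + l * θ + m * θ = 2 * n * θ := by rw [← hs']; ring
  have ta : θ ≤ a * θ := by nlinarith
  have tb : θ ≤ b * θ := by nlinarith
  have tl : 3 * θ ≤ l * θ := by nlinarith
  have tm : 3 * θ ≤ m * θ := by nlinarith
  have sa := (Real.sin_pos_of_pos_of_lt_pi (x := a * θ) (by linarith) (by linarith)).ne'
  have sb := (Real.sin_pos_of_pos_of_lt_pi (x := b * θ) (by linarith) (by linarith)).ne'
  have cl := (Real.cos_pos_of_mem_Ioo (x := l * θ / 2) ⟨by linarith, by linarith⟩).ne'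
  have cm := (Real.cos_pos_of_mem_Ioo (x := m * θ / 2) ⟨by linarith, by linarith⟩).ne'
  have hcont : ContinuousAt (Kf a b l m) θ := by
    unfold Kf
    refine ContinuousAt.sub (ContinuousAt.sub (ContinuousAt.add ?_ ?_) ?_) ?_
    · exact ContinuousAt.div (by fun_prop) (by fun_prop) sa
    · exact ContinuousAt.div (by fun_prop) (by fun_prop) sb
    · exact ContinuousAt.mul continuousAt_const (ContinuousAt.div (by fun_prop) (by fun_prop) cl)
    · exact ContinuousAt.mul continuousAt_const (ContinuousAt.div (by fun_prop) (by fun_prop) cm)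
  have ev1 := hcont.eventually (lt_mem_nhds hK)
  have hcont2 : ContinuousAt (fun t : ℝ => 2 * ((n : ℝ) - 1) * t) θ := by fun_prop
  have ev2 := hcont2.eventually (gt_mem_nhds h1)
  have ev : ∀ᶠ t in nhdsWithin θ (Set.Ioi θ), (0 < Kf a b l m t ∧ 2 * ((n : ℝ) - 1) * t < Real.pi) ∧
      t ∈ Set.Ioi θ := by
    refine Filter.Eventually.and ?_ self_mem_nhdsWithin
    exact nhdsWithin_le_nhds (ev1.and ev2)
  obtain ⟨t, ⟨h3, h4⟩, h5⟩ := ev.exists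
  exact ⟨t, h5, h4, h3.le⟩


lemma pnorm_pos {V : Type*} [Fintype V] {G : SimpleGraph V} {f : V → ℝ}
    (hd : ∃ x, f x ≠ 0 ∧ 0 < deg G x) : 0 < pnorm G 2 f := by
  obtain ⟨x, hx, hdx⟩ := hd
  unfold pnorm
  refine Finset.sum_pos' (fun y _ => by positivity) ⟨x, Finset.mem_univ x, ?_⟩
  have : 0 < |f x| := abs_pos.2 hx
  have : (0 : ℝ) < deg G x := by exact_mod_cast hdx
  positivity

lemma lambda_ge {V : Type*} [Fintype V] {G : SimpleGraph V} (c : ℝ)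
    (hdeg : ∀ x, 0 < deg G x) (hinter : ∃ x, deg G x ≠ 1)
    (h : ∀ f : V → ℝ, (∀ x, deg G x = 1 → f x = 0) →
      0 ≤ 2 * (energy G 2 f - (1 - c) * pnorm G 2 f)) : 1 - c ≤ lambda1 G 2 := by
  unfold lambda1
  apply le_csInf
  · obtain ⟨x, hx⟩ := hinter
    refine ⟨_, fun y => if y = x then 1 else 0, ?_, ?_, rfl⟩
    · intro y hy
      have : y ≠ x := by rintro rfl; exact hx hy
      simp [this]
    · intro h0
      have := congrFun h0 x
      simp at this
  · rintro r ⟨f, hf, hf0, rfl⟩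
    obtain ⟨x, hx⟩ := Function.ne_iff.1 hf0
    have hp : 0 < pnorm G 2 f := pnorm_pos ⟨x, hx, hdeg x⟩
    unfold rayleigh
    rw [le_div_iff₀ hp]
    linarith [h f hf]

lemma lambda_le {V : Type*} [Fintype V] {G : SimpleGraph V} (c : ℝ) (f : V → ℝ)
    (hf : ∀ x, deg G x = 1 → f x = 0) (hd : ∃ x, f x ≠ 0 ∧ 0 < deg G x)
    (h : 2 * (energy G 2 f - (1 - c) * pnorm G 2 f) = 0) : lambda1 G 2 ≤ 1 - c := by
  unfold lambda1
  apply csInf_le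
  · refine ⟨0, ?_⟩
    rintro r ⟨g, _, _, rfl⟩
    unfold rayleigh energy pnorm
    apply div_nonneg
    · apply div_nonneg _ (by norm_num)
      refine Finset.sum_nonneg fun x _ => Finset.sum_nonneg fun y _ => ?_
      split_ifs <;> positivity
    · exact Finset.sum_nonneg fun x _ => by positivity
  · have hp : 0 < pnorm G 2 f := pnorm_pos hd
    refine ⟨f, hf, ?_, ?_⟩
    · rintro rfl
      obtain ⟨x, hx, _⟩ := hd
      exact hx rfl
    · unfold rayleigh
      rw [eq_div_iff hp.ne']
      linarith

lemma deg_iso {V W : Type*} [Fintype V] [Fintype W] {G : SimpleGraph V} {H : SimpleGraph W}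
    (φ : G ≃g H) (x : V) : deg H (φ x) = deg G x := by
  unfold deg
  symm
  refine Finset.card_bij (fun y _ => φ y) ?_ ?_ ?_
  · intro y hy
    have h1 : G.Adj x y := by simpa using hy
    simpa using φ.map_adj_iff.2 h1
  · intro y _ z _ h; exact φ.injective h
  · intro z hz
    refine ⟨φ.symm z, ?_, by simp⟩
    have h1 : H.Adj (φ x) (φ (φ.symm z)) := by simpa using hz
    simpa using φ.map_adj_iff.1 h1

lemma lambda_set_iso {V W : Type*} [Fintype V] [Fintype W] {G : SimpleGraph V}
    {H : SimpleGraph W} (φ : G ≃g H) (r : ℝ)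
    (h : ∃ f : W → ℝ, (∀ x, deg H x = 1 → f x = 0) ∧ f ≠ 0 ∧ r = rayleigh H 2 f) :
    ∃ f : V → ℝ, (∀ x, deg G x = 1 → f x = 0) ∧ f ≠ 0 ∧ r = rayleigh G 2 f := by
  obtain ⟨f, h1, h2, rfl⟩ := h
  refine ⟨fun x => f (φ x), fun x hx => h1 _ (by rw [deg_iso, hx]), ?_, ?_⟩
  · intro h0
    apply h2
    funext y
    have := congrFun h0 (φ.symm y)
    simpa using this
  · have hadj : ∀ x y, H.Adj (φ x) (φ y) = G.Adj x y := fun x y => propext φ.map_adj_iff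
    have e1 : energy H 2 f = energy G 2 (fun x => f (φ x)) := by
      rw [energy_two, energy_two]
      congr 1
      rw [← Equiv.sum_comp φ.toEquiv]
      refine Finset.sum_congr rfl fun x _ => ?_
      rw [← Equiv.sum_comp φ.toEquiv]
      refine Finset.sum_congr rfl fun y _ => ?_
      have : H.Adj (φ.toEquiv x) (φ.toEquiv y) ↔ G.Adj x y := φ.map_adj_iff
      by_cases hxy : G.Adj x y
      · rw [if_pos hxy, if_pos (this.2 hxy)]; rfl
      · rw [if_neg hxy, if_neg (fun h => hxy (this.1 h))]
    have e2 : pnorm H 2 f = pnorm G 2 (fun x => f (φ x)) := by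
      unfold pnorm
      rw [← Equiv.sum_comp φ.toEquiv]
      refine Finset.sum_congr rfl fun x _ => ?_
      have : deg H (φ.toEquiv x) = deg G x := deg_iso φ x
      rw [this]; rfl
    unfold rayleigh
    rw [e1, e2]

lemma lambda_iso {V W : Type*} [Fintype V] [Fintype W] {G : SimpleGraph V} {H : SimpleGraph W}
    (φ : G ≃g H) : lambda1 G 2 = lambda1 H 2 := by
  unfold lambda1
  congr 1
  ext r
  exact ⟨lambda_set_iso φ.symm r, lambda_set_iso φ r⟩

lemma tad_adj {n : ℕ} (a b : Fin n) : (tadpole n 3).Adj a b ↔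
    ((b.val = a.val + 1 ∨ (a.val = 0 ∧ b.val = 2)) ∨ (a.val = b.val + 1 ∨ (b.val = 0 ∧ a.val = 2))) := by
  unfold tadpole
  rw [SimpleGraph.fromRel_adj]
  constructor
  · rintro ⟨_, h⟩; exact h
  · intro h
    refine ⟨?_, h⟩
    rintro rfl
    omega

lemma tad_sum {n : ℕ} (hn : 4 ≤ n) (F : ℕ → ℕ → ℝ) (hF : ∀ i j, F i j = F j i) :
    (∑ x : Fin n, ∑ y : Fin n, if (tadpole n 3).Adj x y then F x y else 0) =
      2 * (∑ i ∈ Finset.range (n - 1), F i (i + 1) + F 0 2) := by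
  let R : ℕ → ℕ → Prop := fun a b => b = a + 1 ∨ (a = 0 ∧ b = 2)
  have h1 : ∀ x y : Fin n, (if (tadpole n 3).Adj x y then F x y else 0) =
      (if R x y then F x y else 0) + (if R y x then F y x else 0) := by
    intro x y
    have := tad_adj x y
    by_cases hxy : R x y
    · have hyx : ¬ R y x := by simp only [R] at hxy ⊢; omega
      rw [if_pos hxy, if_neg hyx, if_pos (this.2 (Or.inl hxy)), add_zero]
    · by_cases hyx : R y x
      · rw [if_neg hxy, if_pos hyx, if_pos (this.2 (Or.inr hyx)), zero_add, hF]
      · rw [if_neg hxy, if_neg hyx, if_neg (fun h => (this.1 h).elim hxy hyx), add_zero]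
  simp only [h1, Finset.sum_add_distrib]
  rw [Finset.sum_comm (f := fun x y : Fin n => if R y x then F y x else 0), ← two_mul]
  congr 1
  have h2 : ∀ a : ℕ, (∑ y : Fin n, if R a y then F a y else 0) =
      (if a < n - 1 then F a (a + 1) else 0) + (if a = 0 then F 0 2 else 0) := by
    intro a
    rw [Fin.sum_univ_eq_sum_range (fun y => if R a y then F a y else 0) n]
    have h3 : ∀ y, (if R a y then F a y else 0) =
        (if y = a + 1 then F a (a + 1) else 0) + (if y = 2 then (if a = 0 then F 0 2 else 0) else 0) := by
      intro y
      by_cases hy : y = a + 1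
      · have : R a y := Or.inl hy
        rw [if_pos this, if_pos hy, hy]
        split_ifs <;> first | omega | simp
      · by_cases hy2 : y = 2
        · by_cases ha : a = 0
          · have : R a y := Or.inr ⟨ha, hy2⟩
            rw [if_pos this, if_neg hy, if_pos hy2, if_pos ha, ha, hy2, zero_add]
          · have : ¬ R a y := by simp only [R]; omega
            simp [this, hy, ha]
        · have : ¬ R a y := by simp only [R]; omega
          simp [this, hy, hy2]
    simp only [h3, Finset.sum_add_distrib]
    rw [Finset.sum_ite_eq', Finset.sum_ite_eq']
    simp only [Finset.mem_range]
    rw [if_pos (by omega : 2 < n)]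
    congr 1
    by_cases h : a < n - 1
    · rw [if_pos h, if_pos (by omega)]
    · rw [if_neg h, if_neg (by omega)]
  simp only [h2]
  rw [Fin.sum_univ_eq_sum_range (fun a => (if a < n - 1 then F a (a + 1) else 0) +
    (if a = 0 then F 0 2 else 0)) n, Finset.sum_add_distrib, Finset.sum_ite_eq']
  rw [if_pos (by simp; omega)]
  congr 1
  obtain ⟨k, rfl⟩ : ∃ k, n = k + 1 := ⟨n - 1, by omega⟩
  rw [Finset.sum_range_succ]
  simp only [Nat.add_sub_cancel, lt_irrefl, if_false, add_zero]
  exact Finset.sum_congr rfl fun i hi => if_pos (Finset.mem_range.1 hi)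

lemma deg_pos_of_adj {V : Type*} [Fintype V] {G : SimpleGraph V} {x y : V} (h : G.Adj x y) :
    0 < deg G x := by
  unfold deg
  exact Finset.card_pos.2 ⟨y, by simpa using h⟩

lemma deg_ne_one_of_adj {V : Type*} [Fintype V] {G : SimpleGraph V} {x y z : V} (h : G.Adj x y)
    (h' : G.Adj x z) (hne : y ≠ z) : deg G x ≠ 1 := by
  unfold deg
  have : 1 < (Finset.univ.filter (fun y => G.Adj x y)).card :=
    Finset.one_lt_card.2 ⟨y, by simpa using h, z, by simpa using h', hne⟩
  omega

lemma sin_tele (θ : ℝ) (k : ℕ) :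
    ∑ j ∈ Finset.range k, eform (Real.cos θ) (Real.sin (j * θ)) (Real.sin ((j + 1 : ℕ) * θ)) =
      Real.sin θ * Real.cos (k * θ) * Real.sin (k * θ) := by
  induction k with
  | zero => simp
  | succ k ih =>
    rw [Finset.sum_range_succ, ih]
    unfold eform
    push_cast
    have e : (k + 1 : ℝ) * θ = k * θ + θ := by ring
    rw [e, Real.sin_add, Real.cos_add]
    have p1 := Real.sin_sq_add_cos_sq (k * θ)
    have p2 := Real.sin_sq_add_cos_sq θ
    set S := Real.sin (k * θ)
    set C := Real.cos (k * θ)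
    set s := Real.sin θ
    set c := Real.cos θ
    have p3 : C ^ 2 = 1 - S ^ 2 := by linarith
    have p4 : s ^ 2 = 1 - c ^ 2 := by linarith
    have p5 : s ^ 3 = s * (1 - c ^ 2) := by rw [← p4]; ring
    ring_nf
    rw [p3, p5, p4]
    ring

lemma tad_le {n : ℕ} (hn : 4 ≤ n) {θ : ℝ} (hr : IsRoot n θ) :
    lambda1 (tadpole n 3) 2 ≤ 1 - Real.cos θ := by
  obtain ⟨h0, h1, h2⟩ := hr
  have hn' : (4 : ℝ) ≤ n := by exact_mod_cast hn
  have h6 : 6 * θ < Real.pi := by nlinarith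
  have hc : 1 / 2 < Real.cos θ := by
    rw [← Real.cos_pi_div_three]
    exact Real.cos_lt_cos_of_nonneg_of_le_pi (by linarith) (by linarith) (by linarith)
  obtain ⟨k, rfl⟩ : ∃ k, n = k + 3 := ⟨n - 3, by omega⟩
  have ek : (((k + 3 : ℕ) : ℝ) - 3) * θ = k * θ := by push_cast; ring
  rw [ek] at h2
  push_cast at h1
  have hk : (1 : ℝ) ≤ k := by push_cast at hn'; linarith
  have tk : θ ≤ k * θ := by nlinarith
  have hS : 0 < Real.sin (k * θ) := Real.sin_pos_of_pos_of_lt_pi (by linarith) (by nlinarith)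
  have hch : 0 < Real.cos (3 / 2 * θ) := Real.cos_pos_of_mem_Ioo ⟨by linarith, by linarith⟩
  set w : ℝ := Real.sin (k * θ) / (2 * Real.cos θ - 1) with hw
  have hwp : 0 < w := div_pos hS (by linarith)
  have hSw : Real.sin (k * θ) = (2 * Real.cos θ - 1) * w := by
    rw [hw]; field_simp [show 2 * Real.cos θ - 1 ≠ 0 by linarith]
  let g : ℕ → ℝ := fun i => if i < 2 then w else Real.sin ((k + 2 - i : ℕ) * θ)
  apply lambda_le (Real.cos θ) (fun x : Fin (k + 3) => g x)
  · intro x hx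
    by_cases hxl : x.val = k + 2
    · simp only [g, hxl]
      rw [if_neg (by omega)]
      simp
    · exfalso
      have hxlt : x.val < k + 2 := by omega
      have a1 : (tadpole (k + 3) 3).Adj x ⟨x.val + 1, by omega⟩ := by
        rw [tad_adj]; simp
      by_cases hx0 : x.val = 0
      · exact deg_ne_one_of_adj a1 (z := ⟨2, by omega⟩) (by rw [tad_adj]; simp [hx0])
          (by simp [Fin.ext_iff, hx0]) hx
      · have hz : x.val - 1 < k + 3 := by omega
        have a2 : (tadpole (k + 3) 3).Adj x ⟨x.val - 1, hz⟩ := by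
          rw [tad_adj]; right; left; simp only []; omega
        refine deg_ne_one_of_adj a1 a2 ?_ hx
        rw [Ne, Fin.mk.injEq]; omega
  · refine ⟨⟨0, by omega⟩, by simp [g, hwp.ne'], ?_⟩
    exact deg_pos_of_adj (y := ⟨1, by omega⟩) (by rw [tad_adj]; simp)
  · rw [form_eq, tad_sum hn (fun i j => eform (Real.cos θ) (g i) (g j))
      (fun i j => eform_comm _ _ _)]
    have e : k + 3 - 1 = k + 2 := rfl
    have g0 : g 0 = w := by simp [g]
    have g1 : g 1 = w := by simp [g]
    have g2 : g 2 = Real.sin (k * θ) := by simp [g]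
    rw [e, Finset.sum_range_succ', Finset.sum_range_succ', ← Finset.sum_range_reflect]
    have : ∑ j ∈ Finset.range k, eform (Real.cos θ) (g (k - 1 - j + 1 + 1)) (g (k - 1 - j + 1 + 1 + 1))
      = ∑ j ∈ Finset.range k, eform (Real.cos θ) (Real.sin (j * θ)) (Real.sin ((j + 1 : ℕ) * θ)) := by
      refine Finset.sum_congr rfl fun j hj => ?_
      have hj := Finset.mem_range.1 hj
      have i1 : k + 2 - (k - 1 - j + 1 + 1) = j + 1 := by omega
      have i2 : k + 2 - (k - 1 - j + 1 + 1 + 1) = j := by omega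
      rw [eform_comm]
      simp only [g]
      rw [if_neg (by omega), if_neg (by omega), i1, i2]
    rw [this, sin_tele]
    simp only [zero_add, g0, g1, show (1 + 1 : ℕ) = 2 from rfl, g2]
    -- the root equation in terms of cos θ
    have hroot : Real.sin θ * Real.cos (k * θ) + 2 * Real.cos θ * Real.sin (k * θ) = 2 * w := by
      have e1 : Real.sin θ * Real.cos (k * θ) * Real.cos (3 / 2 * θ) =
          2 * (Real.sin θ * Real.sin (3 / 2 * θ)) * Real.sin (k * θ) := by
        rw [mul_assoc, h2]; ring
      have e2 : (2 * Real.cos θ - 1) * (Real.sin θ * Real.sin (3 / 2 * θ)) =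
          (1 - Real.cos θ) * (2 * Real.cos θ + 1) * Real.cos (3 / 2 * θ) := by
        have a1 : Real.sin (3 / 2 * θ) = 3 * Real.sin (θ / 2) - 4 * Real.sin (θ / 2) ^ 3 := by
          rw [← Real.sin_three_mul]; congr 1; ring
        have a2 : Real.cos (3 / 2 * θ) = 4 * Real.cos (θ / 2) ^ 3 - 3 * Real.cos (θ / 2) := by
          rw [← Real.cos_three_mul]; congr 1; ring
        have a3 : Real.sin θ = 2 * Real.sin (θ / 2) * Real.cos (θ / 2) := by
          rw [← Real.sin_two_mul]; congr 1; ring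
        have a4 : Real.cos θ = 2 * Real.cos (θ / 2) ^ 2 - 1 := by
          rw [← Real.cos_two_mul]; congr 1; ring
        have p := Real.sin_sq_add_cos_sq (θ / 2)
        rw [a1, a2, a3, a4]
        set S := Real.sin (θ / 2)
        set C := Real.cos (θ / 2)
        have p1 : S ^ 2 = 1 - C ^ 2 := by linarith
        have p2 : S ^ 4 = (1 - C ^ 2) ^ 2 := by rw [← p1]; ring
        ring_nf
        rw [p1, p2]; ring
      have e3 : (2 * Real.cos θ - 1) * Real.cos (3 / 2 * θ) *
          (Real.sin θ * Real.cos (k * θ) + 2 * Real.cos θ * Real.sin (k * θ) - 2 * w) = 0 := by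
        have : (2 * Real.cos θ - 1) * Real.cos (3 / 2 * θ) *
          (Real.sin θ * Real.cos (k * θ) + 2 * Real.cos θ * Real.sin (k * θ) - 2 * w) =
          (2 * Real.cos θ - 1) * (Real.sin θ * Real.cos (k * θ) * Real.cos (3 / 2 * θ)) +
          Real.cos (3 / 2 * θ) * (2 * Real.cos θ * (2 * Real.cos θ - 1) * Real.sin (k * θ)
            - 2 * ((2 * Real.cos θ - 1) * w)) := by ring
        rw [this, e1, ← hSw]
        linear_combination 2 * Real.sin (k * θ) * e2
      have hne : (2 * Real.cos θ - 1) * Real.cos (3 / 2 * θ) ≠ 0 :=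
        mul_ne_zero (by linarith) hch.ne'
      have := (mul_eq_zero.1 e3).resolve_left hne
      linarith
    unfold eform
    linear_combination 2 * Real.sin (k * θ) * hroot - 4 * w * hSw


open SimpleGraph in
lemma iso_of {V : Type*} {G : SimpleGraph V} {n : ℕ} (hn : 4 ≤ n) {p y z : V}
    (P : G.Walk p y) (hP : P.IsPath) (hlen : P.length = n - 1) (hyz : G.Adj y z)
    (hz : P.getVert (n - 3) = z)
    (hE : ∀ u v, G.Adj u v → s(u, v) ∈ P.edges ∨ s(u, v) = s(y, z))
    (hdeg : ∀ x, ∃ u, G.Adj x u) : Nonempty (G ≃g tadpole n 3) := by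
  have hy : P.getVert (n - 1) = y := by rw [← hlen, Walk.getVert_length]
  have hinj : ∀ i j, i ≤ n - 1 → j ≤ n - 1 → P.getVert i = P.getVert j → i = j := by
    intro i j hi hj h
    exact hP.getVert_injOn (by simpa [hlen] using hi) (by simpa [hlen] using hj) h
  have hsupp : ∀ x, ∃ i ≤ n - 1, P.getVert i = x := by
    intro x
    have : x ∈ P.support := by
      obtain ⟨u, hu⟩ := hdeg x
      rcases hE x u hu with h | h
      · exact P.fst_mem_support_of_mem_edges h
      · rw [Sym2.eq_iff] at h
        rcases h with ⟨rfl, rfl⟩ | ⟨rfl, rfl⟩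
        · exact P.end_mem_support
        · rw [← hz]; exact P.getVert_mem_support _
    obtain ⟨i, hi, hi'⟩ := Walk.mem_support_iff_exists_getVert.1 this
    exact ⟨i, by omega, hi⟩
  let g : Fin n → V := fun i => P.getVert (n - 1 - i.val)
  have hbij : Function.Bijective g := by
    constructor
    · intro i j h
      have := hinj _ _ (by omega) (by omega) h
      ext; omega
    · intro x
      obtain ⟨i, hi, rfl⟩ := hsupp x
      refine ⟨⟨n - 1 - i, by omega⟩, ?_⟩
      simp only [g]
      congr 1; omega
  have hadj : ∀ i j : Fin n, G.Adj (g i) (g j) ↔ (tadpole n 3).Adj i j := by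
    intro i j
    rw [tad_adj]
    have hi := i.isLt
    have hj := j.isLt
    constructor
    · intro h
      rcases hE _ _ h with h | h
      · rw [Walk.mk_mem_edges_iff_exists] at h
        obtain ⟨k, hk, h⟩ := h
        rw [hlen] at hk
        rw [Sym2.eq_iff] at h
        rcases h with ⟨h1, h2⟩ | ⟨h1, h2⟩
        · have := hinj _ _ (by omega) (by omega) h1
          have := hinj _ _ (by omega) (by omega) h2
          omega
        · have := hinj _ _ (by omega) (by omega) h1
          have := hinj _ _ (by omega) (by omega) h2
          omega
      · rw [← hy, ← hz, Sym2.eq_iff] at h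
        rcases h with ⟨h1, h2⟩ | ⟨h1, h2⟩
        · have := hinj _ _ (by omega) (by omega) h1
          have := hinj _ _ (by omega) (by omega) h2
          omega
        · have := hinj _ _ (by omega) (by omega) h1
          have := hinj _ _ (by omega) (by omega) h2
          omega
    · have hs : ∀ i j : Fin n, j.val = i.val + 1 → G.Adj (g i) (g j) := by
        intro i j h
        have hj := j.isLt
        have := P.adj_getVert_succ (i := n - 1 - j.val) (by omega)
        simp only [g]
        rw [show n - 1 - i.val = n - 1 - j.val + 1 by omega]
        exact this.symm
      have ht : ∀ i j : Fin n, i.val = 0 → j.val = 2 → G.Adj (g i) (g j) := by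
        intro i j h1 h2
        simp only [g, h1, h2]
        rw [Nat.sub_zero, hy, show n - 1 - 2 = n - 3 by omega, hz]
        exact hyz
      rintro ((h | ⟨h1, h2⟩) | (h | ⟨h1, h2⟩))
      · exact hs _ _ h
      · exact ht _ _ h1 h2
      · exact (hs _ _ h).symm
      · exact (ht _ _ h1 h2).symm
  exact ⟨(⟨Equiv.ofBijective g hbij, fun {i j} => hadj i j⟩ : tadpole n 3 ≃g G).symm⟩

open SimpleGraph in
lemma exists_max_path {V : Type*} [Fintype V] (G : SimpleGraph V) (p : V) :
    ∃ (y : V) (P : G.Walk p y), P.IsPath ∧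
      ∀ (z : V) (Q : G.Walk p z), Q.IsPath → Q.length ≤ P.length := by
  let R : ℕ → Prop := fun k => ∃ (y : V) (Q : G.Walk p y), Q.IsPath ∧ Q.length = k
  have h0 : R 0 := ⟨p, Walk.nil, Walk.IsPath.nil, rfl⟩
  obtain ⟨y, P, hP, hl⟩ := Nat.findGreatest_spec (P := R) (Nat.zero_le (Fintype.card V)) h0
  refine ⟨y, P, hP, fun z Q hQ => ?_⟩
  rw [hl]
  exact Nat.le_findGreatest hQ.length_lt.le ⟨z, Q, hQ, rfl⟩

lemma wsum_append {V : Type*} {G : SimpleGraph V} (c : ℝ) (f : V → ℝ) {x y z : V}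
    (w : G.Walk x y) (w' : G.Walk y z) : wsum c f (w.append w') = wsum c f w + wsum c f w' := by
  simp [wsum]

lemma cos_lt {n : ℕ} (hn : 4 ≤ n) {θ θ' : ℝ} (h0 : 0 < θ) (h : θ < θ')
    (h' : 2 * ((n : ℝ) - 1) * θ' < Real.pi) : 1 - Real.cos θ < 1 - Real.cos θ' := by
  have hn' : (4 : ℝ) ≤ n := by exact_mod_cast hn
  have := Real.cos_lt_cos_of_nonneg_of_le_pi h0.le (by nlinarith : θ' ≤ Real.pi) h
  linarith

lemma len_lt {n l : ℕ} {θ : ℝ} (hn : 4 ≤ n) (h0 : 0 < θ)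
    (h' : 2 * ((n : ℝ) - 1) * θ < Real.pi) (hl : l + 2 ≤ 2 * n) : l * θ < Real.pi := by
  have : (l : ℝ) + 2 ≤ 2 * n := by exact_mod_cast hl
  nlinarith

open SimpleGraph in
lemma dichotomy {V : Type*} [Fintype V] (G : SimpleGraph V)
    (hconn : G.Connected) (hpend : ∃ x : V, deg G x = 1)
    (n : ℕ) (hn : 4 ≤ n) (hedges : G.edgeFinset.card = n) :
    Nonempty (G ≃g tadpole n 3) ∨ lambda1 (tadpole n 3) 2 < lambda1 G 2 := by
  obtain ⟨p, hp⟩ := hpend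
  obtain ⟨w, hw⟩ := Finset.card_eq_one.1 hp
  have hpadj : ∀ z, G.Adj p z ↔ z = w := by
    intro z
    have : z ∈ Finset.univ.filter (fun y => G.Adj p y) ↔ z ∈ ({w} : Finset V) := by rw [hw]
    simpa using this
  have hpw : G.Adj p w := (hpadj w).2 rfl
  have hnb : ∀ x, ∃ u, G.Adj x u := by
    intro x
    obtain ⟨q⟩ := hconn.preconnected x p
    cases q with
    | nil => exact ⟨w, hpw⟩
    | cons h _ => exact ⟨_, h⟩
  have hdeg : ∀ x, 0 < deg G x := fun x => let ⟨_, hu⟩ := hnb x; deg_pos_of_adj hu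
  obtain ⟨v, hwv, hvp⟩ : ∃ v, G.Adj w v ∧ v ≠ p := by
    by_contra hcon
    push Not at hcon
    have hcl : ∀ {a b : V} (q : G.Walk a b), (a = p ∨ a = w) → (b = p ∨ b = w) := by
      intro a b q
      induction q with
      | nil => exact id
      | cons h q ih =>
        intro ha
        apply ih
        rcases ha with rfl | rfl
        · exact Or.inr ((hpadj _).1 h)
        · exact Or.inl (hcon _ h)
    have hsub : G.edgeFinset ⊆ {s(p, w)} := by
      intro e he
      rw [SimpleGraph.mem_edgeFinset] at he
      induction e with
      | _ a b =>
        have he : G.Adj a b := he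
        obtain ⟨q⟩ := hconn.preconnected p a
        rw [Finset.mem_singleton]
        rcases hcl q (Or.inl rfl) with rfl | rfl
        · rw [(hpadj _).1 he]
        · rw [hcon _ he, Sym2.eq_swap]
    have := Finset.card_le_card hsub
    rw [Finset.card_singleton] at this
    omega
  have hinter : ∃ x, deg G x ≠ 1 := ⟨w, deg_ne_one_of_adj hpw.symm hwv hvp.symm⟩
  obtain ⟨y, P, hP, hmax⟩ := exists_max_path G p
  have hP2 : 2 ≤ P.length := by
    have := hmax v (Walk.cons hpw (Walk.cons hwv Walk.nil)) (by
      simp [Walk.cons_isPath_iff, hpw.ne, hwv.ne, hvp.symm])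
    simpa using this
  obtain ⟨θ, hr⟩ := exists_root n hn
  have hT := tad_le hn hr
  have hn' : (4 : ℝ) ≤ n := by exact_mod_cast hn
  by_cases hy : deg G y = 1
  · right
    obtain ⟨P', C', l1, l2, hl, hs⟩ := cover hconn P (Walk.nil : G.Walk y y)
      (by simpa using hP.isTrail.edges_nodup)
    rw [hedges, Walk.length_nil] at hl
    obtain ⟨h0, h1, h2⟩ := hr
    obtain ⟨θ', hθ', hθ2⟩ : ∃ θ', θ < θ' ∧ 2 * ((n : ℝ) - 1) * θ' < Real.pi := by
      have : θ < Real.pi / (2 * ((n : ℝ) - 1)) := by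
        rw [lt_div_iff₀ (by linarith)]; linarith
      obtain ⟨t, ht1, ht2⟩ := exists_between this
      refine ⟨t, ht1, ?_⟩
      rw [lt_div_iff₀ (by linarith)] at ht2; linarith
    have hθ0 : 0 < θ' := h0.trans hθ'
    have := lambda_ge (G := G) (Real.cos θ') hdeg hinter (by
      intro f hf
      rw [← hs]
      have w1 := wsum_dir f hθ0 (P'.append C') (hf p hp)
        (by rw [Walk.length_append]; omega)
        (len_lt hn hθ0 hθ2 (by rw [Walk.length_append]; omega))
      have w2 := wsum_dir f hθ0 P (hf p hp) (by omega) (len_lt hn hθ0 hθ2 (by omega))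
      rw [hf y hy, wsum_append] at w1
      rw [hf y hy] at w2
      have w3 : wsum (Real.cos θ') f (Walk.nil : G.Walk y y) = 0 := by simp [wsum]
      rw [w3]
      simp only [ne_eq, OfNat.ofNat_ne_zero, not_false_eq_true, zero_pow, mul_zero] at w1 w2
      linarith)
    have := cos_lt hn h0 hθ' hθ2
    linarith
  · obtain ⟨z, hyz, hzp⟩ : ∃ z, G.Adj y z ∧ z ≠ P.penultimate := by
      have h1 : 1 < deg G y := by have := hdeg y; omega
      obtain ⟨a, ha, b, hb, hab⟩ := Finset.one_lt_card.1 h1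
      by_cases hh : a = P.penultimate
      · refine ⟨b, by simpa using hb, ?_⟩
        rintro rfl; exact hab hh
      · exact ⟨a, by simpa using ha, hh⟩
    have hnot : s(y, z) ∉ P.edges := fun h => hzp (hP.eq_penultimate_of_mem_edges h)
    have hzs : z ∈ P.support := by
      by_contra h
      have := hmax z _ (hP.concat h hyz)
      rw [Walk.length_concat] at this
      omega
    set P1 := P.takeUntil z hzs with hP1
    set D := P.dropUntil z hzs with hD
    have hPD : P1.append D = P := P.take_spec hzs
    have hlenPD : P1.length + D.length = P.length := by
      rw [← Walk.length_append, hPD]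
    have hedPD : P1.edges ++ D.edges = P.edges := by
      rw [← Walk.edges_append, hPD]
    let C : G.Walk z z := D.concat hyz
    have hClen : C.length = D.length + 1 := Walk.length_concat _ _
    have hCed : C.edges = D.edges ++ [s(y, z)] := by
      simp only [C, Walk.edges_concat, List.concat_eq_append]
    have hPC : P1.edges ++ C.edges = P.edges ++ [s(y, z)] := by
      rw [hCed, ← List.append_assoc, hedPD]
    have hnd : (P1.edges ++ C.edges).Nodup := by
      rw [hPC]
      refine List.Nodup.append hP.isTrail.edges_nodup (List.nodup_singleton _) ?_
      intro e he he'
      rw [List.mem_singleton] at he'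
      rw [he'] at he
      exact hnot he
    have hD2 : 2 ≤ D.length := by
      by_contra hlt
      have hlt : D.length < 2 := by omega
      have hgz : P.getVert P1.length = z := P.getVert_length_takeUntil hzs
      have hgy : P.getVert P.length = y := P.getVert_length
      by_cases h0 : D.length = 0
      · rw [← hlenPD, h0, add_zero, hgz] at hgy
        exact hyz.ne hgy.symm
      · apply hnot
        rw [Walk.mk_mem_edges_iff_exists]
        refine ⟨P1.length, by omega, ?_⟩
        rw [show P1.length + 1 = P.length by omega, hgz, hgy, Sym2.eq_swap]
    have hP1 : 1 ≤ P1.length := by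
      by_contra hlt
      have h0 : P1.length = 0 := by omega
      have hgz : P.getVert P1.length = z := P.getVert_length_takeUntil hzs
      rw [h0, Walk.getVert_zero] at hgz
      subst hgz
      apply hnot
      have hyw : y = w := (hpadj y).1 hyz.symm
      have h1 : G.Adj (P.getVert 0) (P.getVert (0 + 1)) := P.adj_getVert_succ (by omega)
      rw [Walk.getVert_zero] at h1
      rw [Walk.mk_mem_edges_iff_exists]
      refine ⟨0, by omega, ?_⟩
      rw [Walk.getVert_zero, (hpadj _).1 h1, hyw, Sym2.eq_swap]
    obtain ⟨P', C', l1, l2, hl, hs⟩ := cover hconn P1 C hnd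
    rw [hedges] at hl
    by_cases hex : P'.length = P1.length ∧ C'.length = 3 ∧ C.length = 3
    · left
      obtain ⟨e1, e2, e3⟩ := hex
      refine iso_of hn P hP (by omega) hyz ?_ ?_ hnb
      · rw [show n - 3 = P1.length by omega]
        exact P.getVert_length_takeUntil hzs
      · have heq : (P1.edges ++ C.edges).toFinset = G.edgeFinset := by
          apply Finset.eq_of_subset_of_card_le
          · intro e he
            rw [List.mem_toFinset, List.mem_append] at he
            rw [SimpleGraph.mem_edgeFinset]
            rcases he with h | h
            · exact P1.edges_subset_edgeSet h
            · exact C.edges_subset_edgeSet h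
          · rw [List.toFinset_card_of_nodup hnd, List.length_append, Walk.length_edges,
              Walk.length_edges, hedges]
            omega
        intro a b hab
        have : s(a, b) ∈ G.edgeFinset := by rw [SimpleGraph.mem_edgeFinset]; exact hab
        rw [← heq, List.mem_toFinset, hPC, List.mem_append, List.mem_singleton] at this
        exact this
    · right
      obtain ⟨θ', hθ', hθ2, hK⟩ := exists_theta (a := P'.length) (b := P1.length) (l := C'.length)
        (m := C.length) hn hr (by omega) hP1 (by omega) (by omega) (by omega) hex
      obtain ⟨h0, h1, h2⟩ := hr
      have hθ0 : 0 < θ' := h0.trans hθ'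
      have := lambda_ge (G := G) (Real.cos θ') hdeg hinter (by
        intro f hf
        rw [← hs]
        have w1 := wsum_dir f hθ0 P' (hf p hp) (by omega) (len_lt hn hθ0 hθ2 (by omega))
        have w2 := wsum_dir f hθ0 P1 (hf p hp) (by omega) (len_lt hn hθ0 hθ2 (by omega))
        have w3 := wsum_closed f hθ0 C' (len_lt hn hθ0 hθ2 (by omega))
        have w4 := wsum_closed f hθ0 C (len_lt hn hθ0 hθ2 (by omega))
        have hsin : 0 ≤ Real.sin θ' :=
          Real.sin_nonneg_of_nonneg_of_le_pi hθ0.le (by nlinarith)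
        have hKK : 0 ≤ Real.sin θ' * f z ^ 2 * Kf P'.length P1.length C'.length C.length θ' := by
          positivity
        unfold Kf at hKK
        nlinarith)
      have := cos_lt hn h0 hθ' hθ2
      linarith

end FK

/-- Katsuda–Urakawa Faber–Krahn inequality (`p = 2`): among connected finite simple graphs
with at least one pendant vertex and `n ≥ 4` edges, `λ_{1,2}` is minimized exactly
by the tadpole graph `T_{n,3}`. -/
theorem faber_krahn_two {V : Type*} [Fintype V] (G : SimpleGraph V)
    (hconn : G.Connected) (hpend : ∃ x : V, deg G x = 1)
    (n : ℕ) (hn : 4 ≤ n) (hedges : G.edgeFinset.card = n) :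
    lambda1 (tadpole n 3) 2 ≤ lambda1 G 2 ∧
      (lambda1 G 2 = lambda1 (tadpole n 3) 2 ↔ Nonempty (G ≃g tadpole n 3)) := by

  rcases FK.dichotomy G hconn hpend n hn hedges with h | h
  · have e : lambda1 G 2 = lambda1 (tadpole n 3) 2 := h.elim fun φ => FK.lambda_iso φ
    exact ⟨e.ge, fun _ => h, fun _ => e⟩
  · refine ⟨h.le, fun e => absurd e h.ne', fun hi => hi.elim fun φ => FK.lambda_iso φ⟩
end

section
/- Let G be a connected finite simple graph with at least one pendant vertex, consisting of n ≥ 4 edges, and let p > 1. Then λ_{1,p}(G) ≥ λ_{1,p}(T_{n,3}). -/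
attribute [local instance] Classical.propDecidable

open Finset

noncomputable def eE {V : Type*} (p : ℝ) (f : V → ℝ) : Sym2 V → ℝ :=
  Sym2.lift ⟨fun x y => |f x - f y| ^ p, fun x y => by simp only [abs_sub_comm]⟩

noncomputable def eN {V : Type*} (p : ℝ) (f : V → ℝ) : Sym2 V → ℝ :=
  Sym2.lift ⟨fun x y => |f x| ^ p + |f y| ^ p, fun x y => by simp only [add_comm]⟩

lemma double_sum {V : Type*} [Fintype V] (G : SimpleGraph V) (h : Sym2 V → ℝ) :
    (∑ x : V, ∑ y : V, if G.Adj x y then h s(x, y) else 0) = 2 * ∑ e ∈ G.edgeFinset, h e := by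
  have h1 : (∑ x : V, ∑ y : V, if G.Adj x y then h s(x, y) else 0) = ∑ d : G.Dart, h d.edge := by
    rw [← Finset.sum_product', ← Finset.sum_filter]
    refine Finset.sum_bij' (fun q hq => (⟨q, by simpa using hq⟩ : G.Dart)) (fun d _ => d.toProd)
      ?_ ?_ ?_ ?_ ?_
    · intros; simp
    · intro d _; simp [d.adj]
    · intros; rfl
    · intros; rfl
    · intros; rfl
  rw [h1, ← Finset.sum_fiberwise_of_maps_to (s := Finset.univ) (t := G.edgeFinset)
    (g := fun d : G.Dart => d.edge) (by intro d _; simpa using d.edge_mem), Finset.mul_sum]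
  refine Finset.sum_congr rfl fun e he => ?_
  have : ∀ d ∈ Finset.univ.filter (fun d : G.Dart => d.edge = e), h d.edge = h e := by
    intro d hd
    rw [(Finset.mem_filter.1 hd).2]
  rw [Finset.sum_congr rfl this, Finset.sum_const]
  have hc := G.dart_edge_fiber_card e (by simpa using he)
  have hc2 : (Finset.univ.filter (fun d : G.Dart => d.edge = e)).card = 2 := by
    rw [← hc]
  rw [hc2]; simp

lemma energy_eq {V : Type*} [Fintype V] (G : SimpleGraph V) (p : ℝ) (f : V → ℝ) :
    energy G p f = ∑ e ∈ G.edgeFinset, eE p f e := by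
  have := double_sum G (eE p f)
  unfold energy
  simp only [eE, Sym2.lift_mk] at this ⊢
  rw [this]; ring

lemma pnorm_eq_half {V : Type*} [Fintype V] (G : SimpleGraph V) (p : ℝ) (f : V → ℝ) :
    pnorm G p f = (∑ x : V, ∑ y : V, if G.Adj x y then |f x| ^ p + |f y| ^ p else 0) / 2 := by
  have h1 : pnorm G p f = ∑ x : V, ∑ y : V, if G.Adj x y then |f x| ^ p else 0 := by
    unfold pnorm deg
    refine Finset.sum_congr rfl fun x _ => ?_
    rw [← Finset.sum_filter, Finset.sum_const, nsmul_eq_mul, mul_comm]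
  have h2 : (∑ x : V, ∑ y : V, if G.Adj x y then |f x| ^ p else 0)
      = ∑ x : V, ∑ y : V, if G.Adj x y then |f y| ^ p else 0 := by
    rw [Finset.sum_comm]
    simp only [G.adj_comm]
  have h3 : (∑ x : V, ∑ y : V, if G.Adj x y then |f x| ^ p + |f y| ^ p else 0)
      = (∑ x : V, ∑ y : V, if G.Adj x y then |f x| ^ p else 0)
        + ∑ x : V, ∑ y : V, if G.Adj x y then |f y| ^ p else 0 := by
    simp only [← Finset.sum_add_distrib]
    refine Finset.sum_congr rfl fun x _ => Finset.sum_congr rfl fun y _ => ?_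
    split_ifs <;> simp
  rw [h3, ← h2, h1]; ring

lemma pnorm_eq {V : Type*} [Fintype V] (G : SimpleGraph V) (p : ℝ) (f : V → ℝ) :
    pnorm G p f = ∑ e ∈ G.edgeFinset, eN p f e := by
  have := double_sum G (eN p f)
  rw [pnorm_eq_half]
  simp only [eN, Sym2.lift_mk] at this ⊢
  rw [this]; ring

lemma tadpole_adj (n : ℕ) (hn : 4 ≤ n) (x y : Fin n) : (tadpole n 3).Adj x y ↔
    (y.val = x.val + 1 ∨ x.val = y.val + 1 ∨ (x.val = 0 ∧ y.val = 2) ∨ (x.val = 2 ∧ y.val = 0)) := by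
  unfold tadpole
  rw [SimpleGraph.fromRel_adj]
  simp only [ne_eq, Fin.ext_iff]
  omega

lemma tadpole_sum (m : ℕ) (hm : 3 ≤ m) (H : ℕ → ℕ → ℝ) (hH : ∀ i j, H i j = H j i) :
    (∑ x : Fin (m+1), ∑ y : Fin (m+1), if (tadpole (m+1) 3).Adj x y then H x y else 0) / 2
      = ∑ i ∈ range m, H i (i+1) + H 0 2 := by
  have h0 : (∑ x : Fin (m+1), ∑ y : Fin (m+1), if (tadpole (m+1) 3).Adj x y then H x y else 0)
     = ∑ i ∈ range (m+1), ∑ j ∈ range (m+1), ((if j = i + 1 then H i j else 0) +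
        (if i = j + 1 then H i j else 0) + (if i = 0 then if j = 2 then H i j else 0 else 0)
        + (if i = 2 then if j = 0 then H i j else 0 else 0)) := by
    rw [← Fin.sum_univ_eq_sum_range]
    refine Finset.sum_congr rfl fun x _ => ?_
    rw [← Fin.sum_univ_eq_sum_range (fun j => ((if j = x.val + 1 then H x j else 0) +
        (if x.val = j + 1 then H x j else 0) + (if x.val = 0 then if j = 2 then H x j else 0 else 0)
        + (if x.val = 2 then if j = 0 then H x j else 0 else 0)))]
    refine Finset.sum_congr rfl fun y _ => ?_
    simp only [tadpole_adj (m+1) (by omega)]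
    split_ifs <;> first | omega | simp
  have h1 : (∑ i ∈ range (m+1), ∑ j ∈ range (m+1), (if j = i + 1 then H i j else 0))
      = ∑ i ∈ range m, H i (i+1) := by
    rw [Finset.sum_range_succ]
    simp only [Finset.sum_ite_eq', Finset.mem_range]
    simp only [lt_irrefl, if_false, add_zero]
    refine Finset.sum_congr rfl fun i hi => ?_
    rw [if_pos]
    have := Finset.mem_range.1 hi
    omega
  have h2 : (∑ i ∈ range (m+1), ∑ j ∈ range (m+1), (if i = j + 1 then H i j else 0))
      = ∑ i ∈ range m, H i (i+1) := by
    rw [Finset.sum_comm, ← h1]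
    refine Finset.sum_congr rfl fun x _ => Finset.sum_congr rfl fun y _ => ?_
    rw [hH]
  rw [h0]
  simp only [Finset.sum_add_distrib]
  rw [h1, h2]
  have h3 : (∑ i ∈ range (m+1), ∑ j ∈ range (m+1), (if i = 0 then if j = 2 then H i j else 0 else 0))
      = H 0 2 := by
    rw [Finset.sum_eq_single_of_mem 0 (by simp) (by intro b _ hb; simp [hb])]
    rw [Finset.sum_eq_single_of_mem 2 (by simp; omega) (by intro b _ hb; simp [hb])]
    simp
  have h4 : (∑ i ∈ range (m+1), ∑ j ∈ range (m+1), (if i = 2 then if j = 0 then H i j else 0 else 0))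
      = H 0 2 := by
    rw [Finset.sum_eq_single_of_mem 2 (by simp; omega) (by intro b _ hb; simp [hb])]
    rw [Finset.sum_eq_single_of_mem 0 (by simp) (by intro b _ hb; simp [hb])]
    simp [hH 2 0]
  rw [h3, h4]; ring

lemma tadpole_deg (n : ℕ) (hn : 4 ≤ n) (x : Fin n) (hx : deg (tadpole n 3) x = 1) :
    x.val = n - 1 := by
  by_contra hne
  have hlt := x.isLt
  unfold deg at hx
  obtain ⟨a, ha⟩ := Finset.card_eq_one.1 hx
  have key : ∀ y : Fin n, (tadpole n 3).Adj x y → y = a := by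
    intro y hy
    have : y ∈ Finset.univ.filter (fun y => (tadpole n 3).Adj x y) := by simpa using hy
    rw [ha] at this
    simpa using this
  have k1 := key ⟨x.val + 1, by omega⟩ (by rw [tadpole_adj n hn]; simp)
  by_cases h0 : x.val = 0
  · have k2 := key ⟨2, by omega⟩ (by rw [tadpole_adj n hn]; simp [h0])
    rw [← k2] at k1
    simp [Fin.ext_iff, h0] at k1
  · have k2 := key ⟨x.val - 1, by omega⟩ (by rw [tadpole_adj n hn]; simp; omega)
    rw [← k2] at k1
    simp only [Fin.ext_iff] at k1
    omega

/-- Upper bound of the tadpole eigenvalue by a test function. -/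
lemma tadpole_test (m : ℕ) (hm : 3 ≤ m) (p : ℝ) (g : ℕ → ℝ) (hg : g m = 0)
    (hg0 : ∃ i, i ≤ m ∧ g i ≠ 0) (A B : ℝ) (hA : ∑ i ∈ range m, |g i - g (i+1)| ^ p + |g 0 - g 2| ^ p ≤ A)
    (hB : B ≤ ∑ i ∈ range m, (|g i| ^ p + |g (i+1)| ^ p) + (|g 0| ^ p + |g 2| ^ p)) (hBpos : 0 < B) :
    lambda1 (tadpole (m+1) 3) p ≤ A / B := by
  have hE : energy (tadpole (m+1) 3) p (fun x => g x.val) = 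
      ∑ i ∈ range m, |g i - g (i+1)| ^ p + |g 0 - g 2| ^ p :=
    tadpole_sum m hm (fun i j => |g i - g j| ^ p) (fun i j => by rw [abs_sub_comm])
  have hN : pnorm (tadpole (m+1) 3) p (fun x => g x.val) = 
      ∑ i ∈ range m, (|g i| ^ p + |g (i+1)| ^ p) + (|g 0| ^ p + |g 2| ^ p) := by
    rw [pnorm_eq_half]
    exact tadpole_sum m hm (fun i j => |g i| ^ p + |g j| ^ p) (fun i j => by rw [add_comm])
  have hle : lambda1 (tadpole (m+1) 3) p ≤ rayleigh (tadpole (m+1) 3) p (fun x => g x.val) := by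
    refine csInf_le ⟨0, ?_⟩ ⟨_, ?_, ?_, rfl⟩
    · rintro r ⟨f, -, -, rfl⟩
      unfold rayleigh energy pnorm
      refine div_nonneg (div_nonneg (Finset.sum_nonneg fun x _ => Finset.sum_nonneg fun y _ => ?_)
        (by norm_num)) (Finset.sum_nonneg fun x _ => by positivity)
      split_ifs <;> positivity
    · intro x hx
      have := tadpole_deg (m+1) (by omega) x hx
      simp only [this]
      simpa using hg
    · obtain ⟨i, hi, hgi⟩ := hg0
      intro h
      exact hgi (congrFun h ⟨i, by omega⟩)
  refine hle.trans ?_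
  unfold rayleigh
  rw [hE, hN]
  have hnn : 0 ≤ ∑ i ∈ range m, |g i - g (i+1)| ^ p + |g 0 - g 2| ^ p := by positivity
  exact div_le_div₀ (hnn.trans hA) hA hBpos hB

/-- `w 0, …, w k` is a geodesic starting at `v`. -/
def Geo {V : Type*} (G : SimpleGraph V) (v : V) (k : ℕ) (w : ℕ → V) : Prop :=
  w 0 = v ∧ (∀ i, i < k → G.Adj (w i) (w (i+1))) ∧ ∀ i, i ≤ k → G.dist v (w i) = i

lemma exists_geo {V : Type*} (G : SimpleGraph V) (hconn : G.Connected) (v z : V) :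
    ∃ w, Geo G v (G.dist v z) w ∧ w (G.dist v z) = z := by
  obtain ⟨q, hq⟩ := hconn.exists_walk_length_eq_dist v z
  refine ⟨q.getVert, ⟨by simp, fun i hi => q.adj_getVert_succ (by omega), fun i hi => ?_⟩, ?_⟩
  · have h1 : G.dist v (q.getVert i) ≤ i := by
      refine (SimpleGraph.dist_le (q.take i)).trans ?_
      rw [SimpleGraph.Walk.take_length]; omega
    have h2 : G.dist (q.getVert i) z ≤ q.length - i := by
      refine (SimpleGraph.dist_le (q.drop i)).trans ?_
      rw [SimpleGraph.Walk.drop_length]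
    have h3 := hconn.dist_triangle (u := v) (v := q.getVert i) (w := z)
    omega
  · rw [← hq]; simp

/-- The edges off the path. -/
noncomputable def offE {V : Type*} [Fintype V] (G : SimpleGraph V) (k : ℕ) (w : ℕ → V) :
    Finset (Sym2 V) :=
  G.edgeFinset \ (range k).image (fun i => s(w i, w (i+1)))

lemma geo_split {V : Type*} [Fintype V] (G : SimpleGraph V) (v : V) (k : ℕ) (w : ℕ → V)
    (hw : Geo G v k w) : (offE G k w).card + k = G.edgeFinset.card ∧
      ∀ h : Sym2 V → ℝ, ∑ e ∈ G.edgeFinset, h e =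
        ∑ i ∈ range k, h s(w i, w (i+1)) + ∑ e ∈ offE G k w, h e := by
  have hsub : (range k).image (fun i => s(w i, w (i+1))) ⊆ G.edgeFinset := by
    intro e he
    obtain ⟨i, hi, rfl⟩ := Finset.mem_image.1 he
    simpa using hw.2.1 i (by simpa using hi)
  have hinj : Set.InjOn (fun i => s(w i, w (i+1))) (range k : Set ℕ) := by
    intro i hi j hj hij
    simp only [Finset.coe_range, Set.mem_Iio] at hi hj
    have a1 := hw.2.2 i (by omega)
    have a2 := hw.2.2 (i+1) (by omega)
    have b1 := hw.2.2 j (by omega)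
    have b2 := hw.2.2 (j+1) (by omega)
    rcases Sym2.eq_iff.1 hij with ⟨h1, h2⟩ | ⟨h1, h2⟩
    · rw [h1] at a1; omega
    · rw [h1] at a1; rw [h2] at a2; omega
  constructor
  · unfold offE
    have h1 := Finset.card_sdiff_add_card_eq_card hsub
    rw [Finset.card_image_of_injOn hinj, Finset.card_range] at h1
    exact h1
  · intro h
    unfold offE
    rw [← Finset.sum_sdiff hsub, Finset.sum_image hinj, add_comm]

lemma geo_off {V : Type*} [Fintype V] (G : SimpleGraph V) (v : V) (k : ℕ) (w : ℕ → V)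
    (hw : Geo G v k w) (a : V) (ha : G.Adj v a) (hne : a ≠ w 1) : s(v, a) ∈ offE G k w := by
  unfold offE
  rw [Finset.mem_sdiff]
  refine ⟨by simpa using ha, fun hmem => ?_⟩
  obtain ⟨i, hi, he⟩ := Finset.mem_image.1 hmem
  have hi : i < k := by simpa using hi
  have a1 := hw.2.2 i (by omega)
  have a2 := hw.2.2 (i+1) (by omega)
  rcases Sym2.eq_iff.1 he with ⟨h1, h2⟩ | ⟨h1, h2⟩
  · rw [h1, SimpleGraph.dist_self] at a1
    subst a1
    exact hne h2.symm
  · rw [h2, SimpleGraph.dist_self] at a2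
    omega

/-- edges with an end off the path are off the path -/
lemma geo_off2 {V : Type*} [Fintype V] (G : SimpleGraph V) (k : ℕ) (w : ℕ → V)
    (a b : V) (ha : G.Adj a b) (hne : ∀ i, i ≤ k → w i ≠ a) : s(a, b) ∈ offE G k w := by
  unfold offE
  rw [Finset.mem_sdiff]
  refine ⟨by simpa using ha, fun hmem => ?_⟩
  obtain ⟨i, hi, he⟩ := Finset.mem_image.1 hmem
  have hi : i < k := by simpa using hi
  rcases Sym2.eq_iff.1 he with ⟨h1, h2⟩ | ⟨h1, h2⟩
  · exact hne i (by omega) h1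
  · exact hne (i+1) (by omega) h2

lemma geo_case1 {V : Type*} [Fintype V] (G : SimpleGraph V) (p : ℝ) (hp : 1 < p)
    (f : V → ℝ) (v : V) (hf0 : ∀ x, 0 ≤ f x) (hfv : ∀ x, f x ≤ f v) (hv : 0 < f v)
    (n : ℕ) (hn : 4 ≤ n) (hedges : G.edgeFinset.card = n) (hN : 0 < pnorm G p f)
    (k : ℕ) (w : ℕ → V) (hw : Geo G v k w) (hwk : f (w k) = 0)
    (a : V) (ha : G.Adj v a) (hne : a ≠ w 1) (hfa : f a ≤ f (w (3 - (n - k)))) :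
    lambda1 (tadpole n 3) p ≤ rayleigh G p f := by
  have hmem := geo_off G v k w hw a ha hne
  obtain ⟨hcard, hsum⟩ := geo_split G v k w hw
  have hpos : 0 < (offE G k w).card := Finset.card_pos.2 ⟨_, hmem⟩
  obtain ⟨r, hr⟩ : ∃ r, (offE G k w).card = r + 1 := ⟨_, (Nat.succ_pred_eq_of_pos hpos).symm⟩
  have hnr : n = (r + k) + 1 := by omega
  subst hnr
  have h3 : 3 - (r + k + 1 - k) = 2 - r := by omega
  rw [h3] at hfa
  unfold rayleigh
  have hp0 : (0:ℝ) ≤ p := by linarith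
  refine tadpole_test (r + k) (by omega) p (fun j => f (w (j - r))) ?_ ⟨0, by omega, ?_⟩ _ _ ?_ ?_ hN
  · simpa using hwk
  · simp only [Nat.zero_sub, hw.1]; exact hv.ne'
  · rw [energy_eq, hsum, Finset.sum_range_add]
    have e1 : ∑ i ∈ range r, |f (w (i - r)) - f (w (i + 1 - r))| ^ p = 0 := by
      refine Finset.sum_eq_zero fun i hi => ?_
      have : i < r := by simpa using hi
      rw [show i - r = 0 by omega, show i + 1 - r = 0 by omega, sub_self, abs_zero,
        Real.zero_rpow (by linarith)]
    have e2 : ∑ i ∈ range k, |f (w (r + i - r)) - f (w (r + i + 1 - r))| ^ p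
        = ∑ i ∈ range k, eE p f s(w i, w (i+1)) := by
      refine Finset.sum_congr rfl fun i _ => ?_
      rw [show r + i - r = i by omega, show r + i + 1 - r = i + 1 by omega]
      rfl
    rw [e1, e2, zero_add]
    have e3 : |f (w (0 - r)) - f (w (2 - r))| ^ p ≤ eE p f s(v, a) := by
      simp only [eE, Sym2.lift_mk, Nat.zero_sub, hw.1]
      refine Real.rpow_le_rpow (abs_nonneg _) ?_ hp0
      rw [abs_of_nonneg (by linarith [hfv (w (2 - r))]), abs_of_nonneg (by linarith [hfv a])]
      linarith
    have e4 : eE p f s(v, a) ≤ ∑ e ∈ offE G k w, eE p f e := by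
      refine Finset.single_le_sum (f := eE p f) (fun e _ => ?_) hmem
      induction e with
      | _ x y => simp only [eE, Sym2.lift_mk]; positivity
    linarith
  · rw [pnorm_eq, hsum, Finset.sum_range_add]
    have e1 : ∑ i ∈ range r, (|f (w (i - r))| ^ p + |f (w (i + 1 - r))| ^ p)
        = r * (2 * |f v| ^ p) := by
      rw [Finset.sum_congr rfl (g := fun _ => 2 * |f v| ^ p)]
      · simp
      · intro i hi
        have : i < r := by simpa using hi
        rw [show i - r = 0 by omega, show i + 1 - r = 0 by omega, hw.1]; ring
    have e2 : ∑ i ∈ range k, (|f (w (r + i - r))| ^ p + |f (w (r + i + 1 - r))| ^ p)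
        = ∑ i ∈ range k, eN p f s(w i, w (i+1)) := by
      refine Finset.sum_congr rfl fun i _ => ?_
      rw [show r + i - r = i by omega, show r + i + 1 - r = i + 1 by omega]
      rfl
    rw [e1, e2]
    have e3 : eN p f s(v, a) ≤ |f (w (0 - r))| ^ p + |f (w (2 - r))| ^ p := by
      simp only [eN, Sym2.lift_mk, Nat.zero_sub, hw.1]
      have : |f a| ^ p ≤ |f (w (2 - r))| ^ p := by
        refine Real.rpow_le_rpow (abs_nonneg _) ?_ hp0
        rw [abs_of_nonneg (hf0 _), abs_of_nonneg (hf0 _)]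
        exact hfa
      linarith
    have e4 : ∑ e ∈ (offE G k w).erase s(v, a), eN p f e ≤ r * (2 * |f v| ^ p) := by
      have := Finset.sum_le_card_nsmul ((offE G k w).erase s(v, a)) (eN p f) (2 * |f v| ^ p) ?_
      · rw [Finset.card_erase_of_mem hmem, hr] at this
        simpa using this
      · intro e _
        induction e with
        | _ x y =>
          simp only [eN, Sym2.lift_mk]
          have : ∀ x, |f x| ^ p ≤ |f v| ^ p := by
            intro x
            refine Real.rpow_le_rpow (abs_nonneg _) ?_ hp0
            rw [abs_of_nonneg (hf0 _), abs_of_nonneg (hf0 _)]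
            exact hfv x
          linarith [this x, this y]
    have e5 := Finset.add_sum_erase (offE G k w) (eN p f) hmem
    linarith

lemma geo_case2 {V : Type*} [Fintype V] (G : SimpleGraph V) (p : ℝ) (hp : 1 < p)
    (f : V → ℝ) (v : V) (hf0 : ∀ x, 0 ≤ f x) (hv : 0 < f v)
    (n : ℕ) (hn : 4 ≤ n) (hedges : G.edgeFinset.card = n) (hN : 0 < pnorm G p f)
    (k : ℕ) (w : ℕ → V) (hw : Geo G v k w) (hwk : f (w k) = 0)
    (a b : V) (hab : v ≠ b) (hO : offE G k w = {s(v, a), s(a, b)})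
    (hfa : f (w 1) ≤ f a) (hfb : f b ≤ f (w 1)) :
    lambda1 (tadpole n 3) p ≤ rayleigh G p f := by
  obtain ⟨hcard, hsum⟩ := geo_split G v k w hw
  have hne : s(v, a) ≠ s(a, b) := by
    intro h
    rcases Sym2.eq_iff.1 h with ⟨h1, h2⟩ | ⟨h1, h2⟩
    · exact hab (h1.trans h2)
    · exact hab h1
  have hc2 : (offE G k w).card = 2 := by rw [hO, Finset.card_pair hne]
  have hn2 : n = (k + 1) + 1 := by omega
  subst hn2
  have hp0 : (0:ℝ) ≤ p := by linarith
  unfold rayleigh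
  refine tadpole_test (k + 1) (by omega) p (fun j => if j = 0 then f a else f (w (j - 1)))
    ?_ ⟨1, by omega, ?_⟩ _ _ ?_ ?_ hN
  · simpa using hwk
  · simp [hw.1, hv.ne']
  · rw [energy_eq, hsum, Finset.sum_range_succ', hO, Finset.sum_pair hne]
    simp only [eE, Sym2.lift_mk]
    have : |f a - f (w 1)| ^ p ≤ |f a - f b| ^ p := by
      refine Real.rpow_le_rpow (abs_nonneg _) ?_ hp0
      rw [abs_of_nonneg (by linarith), abs_of_nonneg (by linarith)]
      linarith
    simp only [Nat.add_sub_cancel, Nat.add_eq_zero_iff, one_ne_zero, and_false, if_false,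
      if_true, hw.1, zero_add, Nat.sub_self, OfNat.ofNat_ne_zero, Nat.reduceSub]
    rw [abs_sub_comm (f a) (f v)]
    linarith
  · rw [pnorm_eq, hsum, Finset.sum_range_succ', hO, Finset.sum_pair hne]
    simp only [eN, Sym2.lift_mk]
    have : |f b| ^ p ≤ |f (w 1)| ^ p := by
      refine Real.rpow_le_rpow (abs_nonneg _) ?_ hp0
      rw [abs_of_nonneg (hf0 _), abs_of_nonneg (hf0 _)]
      exact hfb
    simp only [Nat.add_sub_cancel, Nat.add_eq_zero_iff, one_ne_zero, and_false, if_false,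
      if_true, hw.1, zero_add, Nat.sub_self, OfNat.ofNat_ne_zero, Nat.reduceSub]
    linarith

lemma exists_other {V : Type*} [Fintype V] (G : SimpleGraph V) (x y : V) (h : G.Adj x y)
    (hd : deg G x ≠ 1) : ∃ z, G.Adj x z ∧ z ≠ y := by
  by_contra hcon
  push Not at hcon
  apply hd
  unfold deg
  rw [Finset.card_eq_one]
  refine ⟨y, ?_⟩
  ext z
  simp only [Finset.mem_filter, Finset.mem_univ, true_and, Finset.mem_singleton]
  exact ⟨hcon z, fun hz => hz ▸ h⟩

lemma main_nonneg {V : Type*} [Fintype V] (G : SimpleGraph V)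
    (hconn : G.Connected) (hpend : ∃ x : V, deg G x = 1)
    (n : ℕ) (hn : 4 ≤ n) (hedges : G.edgeFinset.card = n)
    (p : ℝ) (hp : 1 < p) (f : V → ℝ) (hf0 : ∀ x, 0 ≤ f x) (hfB : ∀ x, deg G x = 1 → f x = 0)
    (hne : f ≠ 0) :
    0 < pnorm G p f ∧ lambda1 (tadpole n 3) p ≤ rayleigh G p f := by
  obtain ⟨z, hz⟩ := hpend
  obtain ⟨v, -, hfv⟩ := Finset.exists_max_image Finset.univ f ⟨z, Finset.mem_univ z⟩
  replace hfv : ∀ x, f x ≤ f v := fun x => hfv x (Finset.mem_univ x)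
  have hv : 0 < f v := by
    by_contra hcon
    apply hne
    funext x
    have := hf0 x
    have := hfv x
    simp only [Pi.zero_apply]
    linarith
  have hint : ∀ x, 0 < f x → deg G x ≠ 1 := fun x hx h => hx.ne' (hfB x h)
  obtain ⟨w, hw, hwz⟩ := exists_geo G hconn v z
  have hvz : v ≠ z := by
    rintro rfl
    exact hint v hv hz
  have hk : 0 < G.dist v z := hconn.pos_dist_of_ne hvz
  generalize G.dist v z = k at *
  have hwk : f (w k) = 0 := by rw [hwz]; exact hfB z hz
  have h01 : G.Adj v (w 1) := by
    have := hw.2.1 0 hk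
    rwa [hw.1] at this
  obtain ⟨a, hva, haw⟩ := exists_other G v (w 1) h01 (hint v hv)
  have hN : 0 < pnorm G p f := by
    unfold pnorm
    have hd : 0 < deg G v := Finset.card_pos.2 ⟨a, by simpa using hva⟩
    refine lt_of_lt_of_le ?_ (Finset.single_le_sum (f := fun x => |f x| ^ p * (deg G x : ℝ))
      (fun x _ => by positivity) (Finset.mem_univ v))
    have : (0:ℝ) < deg G v := by exact_mod_cast hd
    have : 0 < |f v| := abs_pos.2 hv.ne'
    positivity
  refine ⟨hN, ?_⟩
  by_contra hcon
  have c1 : ∀ w, Geo G v k w → f (w k) = 0 → ∀ a, G.Adj v a → a ≠ w 1 →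
      f (w (3 - (n - k))) < f a := by
    intro w hw hwk a ha hne
    by_contra hle
    exact hcon (geo_case1 G p hp f v hf0 hfv hv n hn hedges hN k w hw hwk a ha hne (not_lt.1 hle))
  have hva1 : G.dist v a = 1 := SimpleGraph.dist_eq_one_iff_adj.2 hva
  have hnot : ∀ i, i ≤ k → w i ≠ a := by
    intro i hi h
    have h1 := hw.2.2 i hi
    rw [h, hva1] at h1
    subst h1
    exact haw h.symm
  have hlt := c1 w hw hwk a hva haw
  have hapos : 0 < f a := lt_of_le_of_lt (hf0 _) hlt
  obtain ⟨b, hab, hbv⟩ := exists_other G a v hva.symm (hint a hapos)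
  have m1 := geo_off G v k w hw a hva haw
  have m2 := geo_off2 G k w a b hab hnot
  have hdist : s(v, a) ≠ s(a, b) := by
    intro h
    rcases Sym2.eq_iff.1 h with ⟨h1, h2⟩ | ⟨h1, h2⟩
    · exact hva.ne h1
    · exact hbv h1.symm
  obtain ⟨hcard, -⟩ := geo_split G v k w hw
  have hsub : ({s(v, a), s(a, b)} : Finset (Sym2 V)) ⊆ offE G k w := by
    intro e he
    simp only [Finset.mem_insert, Finset.mem_singleton] at he
    rcases he with rfl | rfl <;> assumption
  have hge := Finset.card_le_card hsub
  rw [Finset.card_pair hdist] at hge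
  have hr2 : n - k = 2 := by
    by_contra hr
    have : 3 - (n - k) = 0 := by omega
    rw [this, hw.1] at hlt
    exact absurd (hfv a) (not_le.2 hlt)
  have hO : offE G k w = {s(v, a), s(a, b)} := by
    symm
    apply Finset.eq_of_subset_of_card_le hsub
    rw [Finset.card_pair hdist]; omega
  simp only [hr2, Nat.reduceSub] at c1 hlt
  by_cases hfb : f b ≤ f (w 1)
  · exact hcon (geo_case2 G p hp f v hf0 hv n hn hedges hN k w hw hwk a b hbv.symm hO hlt.le hfb)
  push Not at hfb
  have hbpos : 0 < f b := lt_of_le_of_lt (hf0 _) hfb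
  obtain ⟨c, hbc, hca⟩ := exists_other G b a hab.symm (hint b hbpos)
  have hbw : ∃ i, i ≤ k ∧ w i = b := by
    by_contra hno
    push Not at hno
    have := geo_off2 G k w b c hbc hno
    rw [hO] at this
    simp only [Finset.mem_insert, Finset.mem_singleton, Sym2.eq_iff] at this
    rcases this with (⟨h1, -⟩ | ⟨h1, -⟩) | (⟨h1, -⟩ | ⟨-, h2⟩)
    · exact hbv h1
    · exact hab.ne h1.symm
    · exact hab.ne h1.symm
    · exact hca h2
  obtain ⟨i, hik, hib⟩ := hbw
  have hdb : G.dist v b ≤ 2 := by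
    have h1 := hconn.dist_triangle (u := v) (v := a) (w := b)
    have h2 : G.dist a b = 1 := SimpleGraph.dist_eq_one_iff_adj.2 hab
    omega
  have hdi := hw.2.2 i hik
  rw [hib] at hdi
  have hi2 : i = 2 := by
    have h0 : i ≠ 0 := by
      rintro rfl
      exact hbv (hib.symm.trans hw.1)
    have h1 : i ≠ 1 := by
      rintro rfl
      rw [hib] at hfb
      exact lt_irrefl _ hfb
    omega
  subst hi2
  have hw' : Geo G v k (Function.update w 1 a) := by
    refine ⟨by simp [hw.1], fun i hi => ?_, fun i hi => ?_⟩
    · by_cases h0 : i = 0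
      · subst h0; simpa [hw.1] using hva
      by_cases h1 : i = 1
      · subst h1; simpa [hib] using hab
      · rw [Function.update_of_ne h1, Function.update_of_ne (by omega)]
        exact hw.2.1 i hi
    · by_cases h1 : i = 1
      · subst h1; simpa using hva1
      · rw [Function.update_of_ne h1]; exact hw.2.2 i hi
  have := c1 _ hw' (by rw [Function.update_of_ne (by omega)]; exact hwk) (w 1) h01
    (by simpa using haw.symm)
  rw [Function.update_self] at this
  linarith

lemma exists_interior {V : Type*} [Fintype V] (G : SimpleGraph V)
    (hconn : G.Connected) (n : ℕ) (hn : 4 ≤ n) (hedges : G.edgeFinset.card = n) :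
    ∃ x : V, deg G x ≠ 1 := by
  by_contra hcon
  push Not at hcon
  have hne : G.edgeFinset.Nonempty := Finset.card_pos.1 (by omega)
  obtain ⟨e, he⟩ := hne
  induction e with
  | _ x y =>
    have hxy : G.Adj x y := by simpa using he
    have uniq : ∀ u s t, G.Adj u s → G.Adj u t → s = t := by
      intro u s t hs ht
      obtain ⟨c, hc⟩ := Finset.card_eq_one.1 (hcon u)
      have h1 : s ∈ Finset.univ.filter (fun y => G.Adj u y) := by simpa using hs
      have h2 : t ∈ Finset.univ.filter (fun y => G.Adj u y) := by simpa using ht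
      rw [hc, Finset.mem_singleton] at h1 h2
      rw [h1, h2]
    have all : ∀ u, u = x ∨ u = y := by
      intro u
      have hr := (SimpleGraph.reachable_iff_reflTransGen x u).1 (hconn.preconnected x u)
      induction hr with
      | refl => left; rfl
      | tail _ h ih =>
        rcases ih with rfl | rfl
        · right; exact uniq _ _ _ h hxy
        · left; exact uniq _ _ _ h hxy.symm
    have hV : Fintype.card V ≤ 2 := by
      rw [← Finset.card_univ]
      refine (Finset.card_le_card (t := {x, y}) ?_).trans Finset.card_le_two
      intro u _
      simpa using all u
    have h1 := G.card_edgeFinset_le_card_choose_two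
    have h2 : (Fintype.card V).choose 2 ≤ Nat.choose 2 2 := Nat.choose_le_choose 2 hV
    simp at h2
    have h3 : G.edgeFinset.card ≤ (Fintype.card V).choose 2 := by convert h1
    omega

/-- Faber–Krahn inequality for the normalized `p`-Laplacian: for any connected finite simple
graph `G` with at least one pendant vertex and `n ≥ 4` edges, and any `p > 1`,
`λ_{1,p}(G) ≥ λ_{1,p}(T_{n,3})`. -/
theorem faber_krahn_p {V : Type*} [Fintype V] (G : SimpleGraph V)
    (hconn : G.Connected) (hpend : ∃ x : V, deg G x = 1)
    (n : ℕ) (hn : 4 ≤ n) (hedges : G.edgeFinset.card = n)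
    (p : ℝ) (hp : 1 < p) :
    lambda1 (tadpole n 3) p ≤ lambda1 G p := by
  unfold lambda1
  refine le_csInf ?_ ?_
  · obtain ⟨x, hx⟩ := exists_interior G hconn n hn hedges
    refine ⟨_, fun y => if y = x then 1 else 0, ?_, ?_, rfl⟩
    · intro y hy
      refine if_neg ?_
      rintro rfl
      exact hx hy
    · intro h
      have := congrFun h x
      simp at this
  · rintro r ⟨f, hfB, hne, rfl⟩
    obtain ⟨hpos, hle⟩ := main_nonneg G hconn hpend n hn hedges p hp (fun x => |f x|)
      (fun x => abs_nonneg _) (fun x hx => by simp [hfB x hx])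
      (fun h => hne (by funext x; simpa using congrFun h x))
    refine hle.trans ?_
    have hN : pnorm G p (fun x => |f x|) = pnorm G p f := by simp [pnorm]
    unfold rayleigh
    rw [hN] at hpos ⊢
    refine div_le_div_of_nonneg_right ?_ hpos.le
    unfold energy
    refine div_le_div_of_nonneg_right ?_ (by norm_num)
    refine Finset.sum_le_sum fun x _ => Finset.sum_le_sum fun y _ => ?_
    split_ifs
    · exact Real.rpow_le_rpow (abs_nonneg _) (abs_abs_sub_abs_le_abs_sub _ _) (by linarith)
    · exact le_rfl
end

section
/- Let G be a connected finite simple graph with n edges, with B(G) ≠ ∅ and Ω(G) ≠ ∅. Then λ_{1,1}(G) ≥ 1/(2n − 1), and equality holds if and only if G has exactly one pendant vertex. -/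
attribute [local instance] Classical.propDecidable

open Finset

theorem aux_deg {V : Type*} [Fintype V] (G : SimpleGraph V) (x : V) : deg G x = G.degree x := by
  unfold deg
  rw [← SimpleGraph.card_neighborFinset_eq_degree]
  congr 1
  ext y
  simp

theorem aux_deg_pos {V : Type*} [Fintype V] (G : SimpleGraph V)
    (hconn : G.Connected) (hB : ∃ x : V, deg G x = 1) (hΩ : ∃ x : V, deg G x ≠ 1) (x : V) :
    0 < deg G x := by
  obtain ⟨a, ha⟩ := hB
  obtain ⟨b, hb⟩ := hΩ
  have hab : a ≠ b := by rintro rfl; exact hb ha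
  have : Nontrivial V := ⟨a, b, hab⟩
  rw [aux_deg]
  exact hconn.preconnected.degree_pos_of_nontrivial x

theorem aux_path {V : Type*} [Fintype V] (G : SimpleGraph V) (f : V → ℝ) {u v : V}
    (p : G.Walk u v) (hp : p.IsPath) :
    2 * |f u - f v| ≤ ∑ x ∈ p.support.toFinset, ∑ y ∈ p.support.toFinset,
      if G.Adj x y then |f x - f y| else 0 := by
  induction p with
  | nil => simp
  | @cons u w v h p ih =>
    rw [SimpleGraph.Walk.cons_isPath_iff] at hp
    have ih' := ih hp.1
    have hu : u ∉ p.support.toFinset := by simpa using hp.2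
    have hw : w ∈ p.support.toFinset := by simp
    rw [SimpleGraph.Walk.support_cons, List.toFinset_cons]
    set S := p.support.toFinset with hS
    rw [Finset.sum_insert hu]
    have e1 : ∑ x ∈ S, ∑ y ∈ insert u S, (if G.Adj x y then |f x - f y| else 0)
        = ∑ x ∈ S, (if G.Adj x u then |f x - f u| else 0)
          + ∑ x ∈ S, ∑ y ∈ S, (if G.Adj x y then |f x - f y| else 0) := by
      rw [← Finset.sum_add_distrib]
      exact Finset.sum_congr rfl (fun x _ => Finset.sum_insert hu)
    rw [e1]
    have h1 : |f u - f w| ≤ ∑ y ∈ insert u S, (if G.Adj u y then |f u - f y| else 0) := by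
      have := Finset.single_le_sum (f := fun y => if G.Adj u y then |f u - f y| else 0)
        (s := insert u S) (fun y _ => by split_ifs <;> positivity)
        (Finset.mem_insert_of_mem hw)
      simpa [h] using this
    have h2 : |f w - f u| ≤ ∑ x ∈ S, (if G.Adj x u then |f x - f u| else 0) := by
      have := Finset.single_le_sum (f := fun x => if G.Adj x u then |f x - f u| else 0)
        (s := S) (fun y _ => by split_ifs <;> positivity) hw
      simpa [h.symm] using this
    have h3 := abs_sub_le (f u) (f w) (f v)
    have h4 := abs_sub_comm (f u) (f w)
    linarith

theorem aux_energy {V : Type*} [Fintype V] (G : SimpleGraph V) (hconn : G.Connected)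
    (f : V → ℝ) (u v : V) : |f u - f v| ≤ energy G 1 f := by
  obtain ⟨p, hp⟩ := hconn.preconnected.exists_isPath u v
  have h := aux_path G f p hp
  unfold energy
  simp only [Real.rpow_one]
  have h2 : ∑ x ∈ p.support.toFinset, ∑ y ∈ p.support.toFinset,
      (if G.Adj x y then |f x - f y| else 0) ≤
      ∑ x : V, ∑ y : V, if G.Adj x y then |f x - f y| else 0 := by
    have hn : ∀ x y : V, 0 ≤ (if G.Adj x y then |f x - f y| else 0) := by
      intro x y; split_ifs <;> positivity
    calc _ ≤ ∑ x ∈ p.support.toFinset, ∑ y : V, (if G.Adj x y then |f x - f y| else 0) :=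
          Finset.sum_le_sum (fun x _ => Finset.sum_le_sum_of_subset_of_nonneg
            (Finset.subset_univ _) (fun y _ _ => hn x y))
      _ ≤ _ := Finset.sum_le_sum_of_subset_of_nonneg (Finset.subset_univ _)
            (fun x _ _ => Finset.sum_nonneg (fun y _ => hn x y))
  linarith

theorem aux_vol {V : Type*} [Fintype V] (G : SimpleGraph V) (n : ℕ)
    (hedges : G.edgeFinset.card = n) :
    ∑ x ∈ univ.filter (fun x : V => ¬ deg G x = 1), (deg G x : ℝ) =
      2 * (n : ℝ) - ((univ.filter (fun x : V => deg G x = 1)).card : ℝ) := by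
  have h1 : ∑ x : V, deg G x = 2 * n := by
    rw [← hedges, ← SimpleGraph.sum_degrees_eq_twice_card_edges]
    exact Finset.sum_congr rfl (fun x _ => aux_deg G x)
  have h2 := Finset.sum_filter_add_sum_filter_not univ (fun x : V => deg G x = 1)
    (fun x => (deg G x : ℝ))
  have h3 : ∑ x ∈ univ.filter (fun x : V => deg G x = 1), (deg G x : ℝ) =
      ((univ.filter (fun x : V => deg G x = 1)).card : ℝ) := by
    rw [Finset.card_eq_sum_ones, Nat.cast_sum]
    refine Finset.sum_congr rfl (fun x hx => ?_)
    rw [(Finset.mem_filter.1 hx).2]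
  have h4 : ∑ x : V, (deg G x : ℝ) = 2 * (n : ℝ) := by exact_mod_cast h1
  linarith

theorem aux_pnorm_pos {V : Type*} [Fintype V] (G : SimpleGraph V)
    (hpos : ∀ x, 0 < deg G x) (f : V → ℝ) (hf : f ≠ 0) : 0 < pnorm G 1 f := by
  obtain ⟨x, hx⟩ := Function.ne_iff.1 hf
  unfold pnorm
  simp only [Real.rpow_one]
  refine Finset.sum_pos' (fun y _ => by positivity) ⟨x, Finset.mem_univ _, ?_⟩
  have : (0 : ℝ) < deg G x := by exact_mod_cast hpos x
  exact mul_pos (abs_pos.2 hx) this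

theorem aux_rayleigh {V : Type*} [Fintype V] (G : SimpleGraph V) (hconn : G.Connected)
    (hB : ∃ x : V, deg G x = 1) (hΩ : ∃ x : V, deg G x ≠ 1) (f : V → ℝ)
    (hf0 : ∀ x : V, deg G x = 1 → f x = 0) (hf : f ≠ 0) :
    1 / ∑ x ∈ univ.filter (fun x : V => ¬ deg G x = 1), (deg G x : ℝ) ≤ rayleigh G 1 f := by
  have hpos := aux_deg_pos G hconn hB hΩ
  obtain ⟨b, hb⟩ := hB
  have hle : ∀ x, |f x| ≤ energy G 1 f := by
    intro x
    have := aux_energy G hconn f x b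
    rwa [hf0 b hb, sub_zero] at this
  have hp := aux_pnorm_pos G hpos f hf
  have hbound : pnorm G 1 f ≤ energy G 1 f *
      ∑ x ∈ univ.filter (fun x : V => ¬ deg G x = 1), (deg G x : ℝ) := by
    unfold pnorm
    simp only [Real.rpow_one]
    rw [Finset.mul_sum, Finset.sum_filter]
    refine Finset.sum_le_sum (fun x _ => ?_)
    split_ifs with h
    · simp [hf0 x h]
    · exact mul_le_mul_of_nonneg_right (hle x) (by positivity)
  have hD : 0 < ∑ x ∈ univ.filter (fun x : V => ¬ deg G x = 1), (deg G x : ℝ) := by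
    obtain ⟨x, hx⟩ := hΩ
    exact Finset.sum_pos (fun y _ => by exact_mod_cast hpos y) ⟨x, by simpa using hx⟩
  unfold rayleigh
  rw [div_le_div_iff₀ hD hp]
  linarith

theorem aux_upper {V : Type*} [Fintype V] (G : SimpleGraph V)
    (v : V) (hv : ∀ x, deg G x = 1 ↔ x = v) :
    rayleigh G 1 (fun x => if deg G x = 1 then 0 else 1) ≤
      1 / ∑ x ∈ univ.filter (fun x : V => ¬ deg G x = 1), (deg G x : ℝ) := by
  have hp : pnorm G 1 (fun x => if deg G x = 1 then 0 else 1) =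
      ∑ x ∈ univ.filter (fun x : V => ¬ deg G x = 1), (deg G x : ℝ) := by
    unfold pnorm
    simp only [Real.rpow_one]
    rw [Finset.sum_filter]
    refine Finset.sum_congr rfl (fun x _ => ?_)
    by_cases h : deg G x = 1 <;> simp [h]
  unfold rayleigh
  rw [hp]
  refine div_le_div_of_nonneg_right ?_ (Finset.sum_nonneg (fun x _ => by positivity))
  unfold energy
  simp only [Real.rpow_one, hv]
  have hd : deg G v = 1 := (hv v).2 rfl
  have hc1 : ∑ y : V, (if G.Adj v y then (1 : ℝ) else 0) = 1 := by
    rw [Finset.sum_boole]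
    exact_mod_cast hd
  have key : ∀ x y : V, (if G.Adj x y then
      |(if x = v then (0 : ℝ) else 1) - (if y = v then 0 else 1)| else 0) ≤
      (if x = v then (if G.Adj v y then (1 : ℝ) else 0) else 0) +
      (if y = v then (if G.Adj v x then (1 : ℝ) else 0) else 0) := by
    intro x y
    by_cases hx : x = v
    · subst hx
      by_cases hy : y = x
      · subst hy; simp
      · by_cases ha : G.Adj x y <;> simp [hy, ha]
    · by_cases hy : y = v
      · subst hy
        by_cases ha : G.Adj x y
        · simp [hx, ha, ha.symm]
        · simp only [ha, if_false]; split_ifs <;> norm_num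
      · simp [hx, hy]
  have hs := Finset.sum_le_sum (s := univ) (fun x (_ : x ∈ (univ : Finset V)) =>
    Finset.sum_le_sum (s := univ) (fun y (_ : y ∈ (univ : Finset V)) => key x y))
  have hr : ∑ x : V, ∑ y : V, ((if x = v then (if G.Adj v y then (1 : ℝ) else 0) else 0) +
      (if y = v then (if G.Adj v x then (1 : ℝ) else 0) else 0)) = 2 := by
    simp only [Finset.sum_add_distrib]
    rw [Finset.sum_comm]
    simp only [Finset.sum_ite_eq', Finset.mem_univ, if_true]
    rw [hc1]; norm_num
  rw [hr] at hs
  linarith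

/-- For a connected finite simple graph `G` with `n` edges, nonempty boundary and nonempty
interior, `λ_{1,1}(G) ≥ 1/(2n-1)`, with equality iff `G` has exactly one pendant vertex. -/
theorem lambda1_one_lower_bound {V : Type*} [Fintype V] (G : SimpleGraph V)
    (hconn : G.Connected) (n : ℕ) (hedges : G.edgeFinset.card = n)
    (hB : ∃ x : V, deg G x = 1) (hΩ : ∃ x : V, deg G x ≠ 1) :
    1 / (2 * (n : ℝ) - 1) ≤ lambda1 G 1 ∧
      (lambda1 G 1 = 1 / (2 * (n : ℝ) - 1) ↔
        (Finset.univ.filter (fun x : V => deg G x = 1)).card = 1) := by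
  set b := (Finset.univ.filter (fun x : V => deg G x = 1)).card with hb
  have hpos := aux_deg_pos G hconn hB hΩ
  have hvol := aux_vol G n hedges
  rw [← hb] at hvol
  have hD : 0 < ∑ x ∈ univ.filter (fun x : V => ¬ deg G x = 1), (deg G x : ℝ) := by
    obtain ⟨x, hx⟩ := hΩ
    exact Finset.sum_pos (fun y _ => by exact_mod_cast hpos y) ⟨x, by simpa using hx⟩
  have hb1 : 1 ≤ b := by
    obtain ⟨x, hx⟩ := hB
    exact Finset.card_pos.2 ⟨x, by simpa using hx⟩
  have hb1' : (1 : ℝ) ≤ b := by exact_mod_cast hb1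
  have hmem : rayleigh G 1 (fun x => if deg G x = 1 then 0 else 1) ∈
      { r : ℝ | ∃ f : V → ℝ, (∀ x : V, deg G x = 1 → f x = 0) ∧ f ≠ 0 ∧ r = rayleigh G 1 f } := by
    refine ⟨_, fun x hx => by simp [hx], ?_, rfl⟩
    obtain ⟨x, hx⟩ := hΩ
    intro h
    have := congrFun h x
    simp [hx] at this
  have hlow : ∀ r ∈ { r : ℝ | ∃ f : V → ℝ, (∀ x : V, deg G x = 1 → f x = 0) ∧ f ≠ 0 ∧
      r = rayleigh G 1 f }, 1 / (2 * (n : ℝ) - b) ≤ r := by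
    rintro r ⟨f, hf0, hf, rfl⟩
    rw [← hvol]
    exact aux_rayleigh G hconn hB hΩ f hf0 hf
  have hl : 1 / (2 * (n : ℝ) - b) ≤ lambda1 G 1 := le_csInf ⟨_, hmem⟩ hlow
  rw [hvol] at hD
  have hmono : 1 / (2 * (n : ℝ) - 1) ≤ 1 / (2 * (n : ℝ) - b) :=
    one_div_le_one_div_of_le hD (by linarith)
  refine ⟨hmono.trans hl, ?_, ?_⟩
  · intro h
    by_contra hne
    have h2 : (1 : ℝ) < b := by exact_mod_cast (lt_of_le_of_ne hb1 (Ne.symm hne))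
    have : 1 / (2 * (n : ℝ) - 1) < 1 / (2 * (n : ℝ) - b) :=
      one_div_lt_one_div_of_lt hD (by linarith)
    linarith
  · intro h
    refine le_antisymm ?_ (hmono.trans hl)
    obtain ⟨v, hv⟩ := Finset.card_eq_one.1 (hb ▸ h)
    have hv' : ∀ x, deg G x = 1 ↔ x = v := by
      intro x
      have := Finset.ext_iff.1 hv x
      simpa using this
    have hu := aux_upper G v hv'
    rw [hvol, h, Nat.cast_one] at hu
    exact (csInf_le ⟨_, hlow⟩ hmem).trans hu
end
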